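/- There exist absolute constants C ≥ 1 and c ≥ 1 such that for every odd prime p, every λ ∈ F_p with λ ≠ 0 and all finite sets A, B, C, D ⊆ F_p one has I_λ(A,B,C,D) − |A||B||C||D|/p ≤ C (log p)^c ( |A|^{1/4} |B||C| |D|^{1/2} + |A|^{3/4} (|B||C|)^{19/24} |D|^{1/2} E⁺(B,C)^{1/24} ). -/

import Mathlib

open Finset

/-- The number of quadruples `(a,b,c,d) ∈ A×B×C×D` with `(a+b)(c+d) = λ` in `F_p`. -/
def hypCount (p : ℕ) (lam : ZMod p) (A B C D : Finset (ZMod p)) : ℕ :=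
  (((A ×ˢ B) ×ˢ (C ×ˢ D)).filter fun x => (x.1.1 + x.1.2) * (x.2.1 + x.2.2) = lam).card

/-- Common additive energy `E⁺(X,Y) = #{(x₁,x₂,y₁,y₂) ∈ X×X×Y×Y : x₁+y₁ = x₂+y₂}`. -/
def addEnergy (p : ℕ) (X Y : Finset (ZMod p)) : ℕ :=
  (((X ×ˢ X) ×ˢ (Y ×ˢ Y)).filter fun t => t.1.1 + t.2.1 = t.1.2 + t.2.2).card

lemma det_totalDegree_le {K : Type*} [Field K] {σ : Type*} (n b : ℕ)
    (M : Matrix (Fin n) (Fin n) (MvPolynomial σ K)) (h : ∀ i j, (M i j).totalDegree ≤ b) :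
    M.det.totalDegree ≤ n * b := by
  rw [Matrix.det_apply]
  refine (MvPolynomial.totalDegree_finsetSum _ _).trans (Finset.sup_le fun s _ => ?_)
  have h1 : (∏ i, M (s i) i).totalDegree ≤ n * b := by
    refine (MvPolynomial.totalDegree_finsetProd _ _).trans ?_
    refine (Finset.sum_le_sum fun i _ => h (s i) i).trans ?_
    simp
  rcases Int.units_eq_one_or (Equiv.Perm.sign s) with h2 | h2
  · rw [h2]; simpa using h1
  · rw [h2]; simpa using h1

lemma coeff_fse_le {K : Type*} [Field K] (F : MvPolynomial (Fin 3) K) (i : ℕ) :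
    ((MvPolynomial.finSuccEquiv K 2 F).coeff i).totalDegree ≤ F.totalDegree := by
  by_cases h : (MvPolynomial.finSuccEquiv K 2 F).coeff i = 0
  · rw [h]; simp
  · have := MvPolynomial.totalDegree_coeff_finSuccEquiv_add_le F i h
    omega

lemma exists_res {K : Type*} [Field K] (F G : MvPolynomial (Fin 3) K) (e : ℕ)
    (hF : Irreducible F) (hd : F.degreeOf 0 ≠ 0) (hG : ¬ F ∣ G)
    (hFe : F.totalDegree ≤ e) (hGe : G.totalDegree ≤ 3 * e) :
    ∃ R : MvPolynomial (Fin 2) K, R ≠ 0 ∧ R.totalDegree ≤ 12 * e ^ 2 ∧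
      ∀ z x y, MvPolynomial.eval ![z,x,y] F = 0 → MvPolynomial.eval ![z,x,y] G = 0 →
        MvPolynomial.eval ![x,y] R = 0 := by
  classical
  set φ := MvPolynomial.finSuccEquiv K 2 with hφ
  set f := φ F with hf
  set g := φ G with hg
  have hfirr : Irreducible f := (MulEquiv.irreducible_iff φ).2 hF
  have hfd : f.natDegree ≠ 0 := by rw [hf, hφ, MvPolynomial.natDegree_finSuccEquiv]; exact hd
  have hndv : ¬ f ∣ g := by rwa [hf, hg, map_dvd_iff φ]
  have hprim : f.IsPrimitive := hfirr.isPrimitive hfd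
  let L := FractionRing (MvPolynomial (Fin 2) K)
  let : NormalizedGCDMonoid (MvPolynomial (Fin 2) K) := Classical.arbitrary _
  have hirr' : Irreducible (f.map (algebraMap _ L)) :=
    (hprim.irreducible_iff_irreducible_map_fraction_map (K := L)).1 hfirr
  have hndv' : ¬ f.map (algebraMap _ L) ∣ g.map (algebraMap _ L) := by
    rwa [← hprim.dvd_iff_fraction_map_dvd_fraction_map L]
  have hcop : IsCoprime (f.map (algebraMap _ L)) (g.map (algebraMap _ L)) :=
    (hirr'.coprime_iff_not_dvd).2 hndv'
  have hres : Polynomial.resultant (f.map (algebraMap _ L)) (g.map (algebraMap _ L)) ≠ 0 := by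
    intro h
    exact (Polynomial.resultant_eq_zero_iff.1 h).2 hcop
  have hinj : Function.Injective (algebraMap (MvPolynomial (Fin 2) K) L) :=
    IsFractionRing.injective _ _
  rw [Polynomial.natDegree_map_eq_of_injective hinj, Polynomial.natDegree_map_eq_of_injective hinj,
    Polynomial.resultant_map_map] at hres
  have hne : Polynomial.resultant f g ≠ 0 := by
    intro h; rw [h] at hres; simp at hres
  refine ⟨Polynomial.resultant f g, hne, ?_, ?_⟩
  · have hfe : f.natDegree ≤ e := by
      rw [hf, hφ, MvPolynomial.natDegree_finSuccEquiv]
      exact (MvPolynomial.degreeOf_le_totalDegree _ _).trans hFe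
    have hge : g.natDegree ≤ 3 * e := by
      rw [hg, hφ, MvPolynomial.natDegree_finSuccEquiv]
      exact (MvPolynomial.degreeOf_le_totalDegree _ _).trans hGe
    have := det_totalDegree_le (f.natDegree + g.natDegree) (3 * e)
      (Polynomial.sylvester f g f.natDegree g.natDegree) (by
        intro i j
        induction j using Fin.addCases with
        | left j =>
          simp only [Polynomial.sylvester, Matrix.of_apply, Fin.addCases_left]
          split_ifs
          · exact (coeff_fse_le G _).trans hGe
          · simp
        | right j =>
          simp only [Polynomial.sylvester, Matrix.of_apply, Fin.addCases_right]
          split_ifs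
          · exact (coeff_fse_le F _).trans (by omega)
          · simp)
    refine this.trans ?_
    calc (f.natDegree + g.natDegree) * (3 * e) ≤ (e + 3 * e) * (3 * e) := by gcongr
      _ = 12 * e ^ 2 := by ring
  · intro z x y h1 h2
    obtain ⟨P, Q, -, -, h⟩ := Polynomial.exists_mul_add_mul_eq_C_resultant f g le_rfl le_rfl
      (Or.inl hfd)
    have e1 : Polynomial.eval z (Polynomial.map (MvPolynomial.eval ![x,y]) f) = 0 := by
      rw [← h1]; exact (MvPolynomial.eval_eq_eval_mv_eval' ![x,y] z F).symm
    have e2 : Polynomial.eval z (Polynomial.map (MvPolynomial.eval ![x,y]) g) = 0 := by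
      rw [← h2]; exact (MvPolynomial.eval_eq_eval_mv_eval' ![x,y] z G).symm
    have h3 := congrArg (fun q => Polynomial.eval z (Polynomial.map (MvPolynomial.eval ![x,y]) q)) h
    simp only [Polynomial.map_add, Polynomial.map_mul, Polynomial.eval_add, Polynomial.eval_mul,
      e1, e2, zero_mul, add_zero, Polynomial.map_C, Polynomial.eval_C] at h3
    exact h3.symm

/-- A nonzero polynomial vanishing on planes has few planes. -/
lemma card_le_of_root {K ι : Type*} [Field K] [DecidableEq ι] (q : Polynomial K) (hq : q ≠ 0)
    (S : Finset ι) (f : ι → K) (hf : Set.InjOn f S) (h : ∀ i ∈ S, q.eval (f i) = 0) (d : ℕ)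
    (hd : q.natDegree ≤ d) : S.card ≤ d := by
  classical
  have h1 : (S.image f) ⊆ q.roots.toFinset := by
    intro t ht
    obtain ⟨i, hi, rfl⟩ := Finset.mem_image.1 ht
    simp [hq, h i hi]
  calc S.card = (S.image f).card := (Finset.card_image_of_injOn hf).symm
    _ ≤ q.roots.toFinset.card := Finset.card_le_card h1
    _ ≤ Multiset.card q.roots := q.roots.toFinset_card_le
    _ ≤ q.natDegree := q.card_roots'
    _ ≤ d := hd

lemma eval_aeval' {K σ : Type*} [Field K] (w : σ → Polynomial K) (F : MvPolynomial σ K) (t : K) :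
    (MvPolynomial.aeval w F).eval t = MvPolynomial.eval (fun i => (w i).eval t) F := by
  induction F using MvPolynomial.induction_on with
  | C a => simp
  | add p q hp hq => simp [hp, hq]
  | mul_X p i hp => simp [hp]

lemma bezout_lite {K ι : Type*} [Field K] [Infinite K] [DecidableEq ι]
    (F G : MvPolynomial (Fin 3) K) (e : ℕ)
    (hF : Irreducible F) (hd : F.degreeOf 0 ≠ 0) (hG : ¬ F ∣ G)
    (hFe : F.totalDegree ≤ e) (hGe : G.totalDegree ≤ 3 * e)
    (S : Finset ι) (f μ κ : ι → K) (hf : Set.InjOn f S)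
    (h1 : ∀ i ∈ S, ∀ y, MvPolynomial.eval ![μ i * y + κ i, f i, y] F = 0)
    (h2 : ∀ i ∈ S, ∀ y, MvPolynomial.eval ![μ i * y + κ i, f i, y] G = 0) :
    S.card ≤ 12 * e ^ 2 := by
  obtain ⟨R, hR, hRd, hRv⟩ := exists_res F G e hF hd hG hFe hGe
  have : ∃ v : Fin 2 → K, MvPolynomial.eval v R ≠ 0 := by
    by_contra hcon
    push Not at hcon
    exact hR (MvPolynomial.funext fun v => by simp [hcon v])
  obtain ⟨v, hv⟩ := this
  let w : Fin 2 → Polynomial K := ![Polynomial.X, Polynomial.C (v 1)]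
  have hev : ∀ t, (MvPolynomial.aeval w R).eval t = MvPolynomial.eval ![t, v 1] R := by
    intro t
    rw [eval_aeval']
    congr 2
    ext i; fin_cases i <;> simp [w]
  refine card_le_of_root (MvPolynomial.aeval w R) ?_ S f hf ?_ _ ?_
  · intro h0
    have := hev (v 0)
    rw [h0, Polynomial.eval_zero] at this
    apply hv
    rw [this]
    congr 2
    ext i; fin_cases i <;> simp
  · intro i hi
    rw [hev]
    exact hRv _ _ _ (h1 i hi (v 1)) (h2 i hi (v 1))
  · refine (MvPolynomial.aeval_natDegree_le (n := 1) R hRd w ?_).trans (by omega)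
    intro i; fin_cases i <;> simp [w]

/-- ODE lemma. -/
lemma ode_lemma {K : Type*} [Field K] (p : ℕ) [CharP K p] (k : ℕ)
    (Q w : Polynomial K) (hQ : Q ≠ 0) (h : Q * w.derivative = k * Q.derivative * w)
    (hw : w.natDegree < p) (hk : k * Q.natDegree < p) : ∃ α : K, w = Polynomial.C α * Q ^ k := by
  -- claim
  have key : ∀ v : Polynomial K, v ≠ 0 → Q * v.derivative = k * Q.derivative * v →
      v.natDegree < p → v.natDegree = k * Q.natDegree := by
    intro v hv h1 h2
    have h3 := congrArg (fun P => Polynomial.coeff P (Q.natDegree + v.natDegree - 1)) h1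
    have cQ : Q.leadingCoeff ≠ 0 := by simpa using hQ
    have cv : v.leadingCoeff ≠ 0 := by simpa using hv
    have gen : ∀ U V : Polynomial K, V.natDegree ≠ 0 →
        (U * V.derivative).coeff (U.natDegree + V.natDegree - 1) =
        U.leadingCoeff * (V.natDegree * V.leadingCoeff) := by
      intro U V hV
      rw [show U.natDegree + V.natDegree - 1 = U.natDegree + (V.natDegree - 1) by omega]
      rw [Polynomial.coeff_mul_add_eq_of_natDegree_le le_rfl (Polynomial.natDegree_derivative_le V),
        Polynomial.coeff_derivative, show V.natDegree - 1 + 1 = V.natDegree by omega]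
      rw [← Nat.cast_add_one, show V.natDegree - 1 + 1 = V.natDegree by omega]
      simp only [Polynomial.leadingCoeff]; ring
    have gen' : ∀ U V : Polynomial K, 
        V.natDegree = 0 → V.derivative = 0 := by
      intro U V hV
      rw [Polynomial.eq_C_of_natDegree_eq_zero hV]; simp
    have h4 : (v.natDegree : K) = (k * Q.natDegree : ℕ) := by
      by_cases d1 : v.natDegree = 0
      · rw [gen' Q v d1, mul_zero] at h1
        have h5 : (k : Polynomial K) * Q.derivative = 0 := by
          rcases mul_eq_zero.1 h1.symm with h5 | h5
          · exact h5
          · exact absurd h5 hv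
        by_cases d2 : Q.natDegree = 0
        · simp [d1, d2]
        · have := congrArg (fun P => Polynomial.coeff P (Q.natDegree - 1)) h5
          simp only [Polynomial.coeff_natCast_mul, Polynomial.coeff_derivative,
            Polynomial.coeff_zero] at this
          rw [← Nat.cast_add_one, show Q.natDegree - 1 + 1 = Q.natDegree by omega] at this
          have h6 : ((k : K) * Q.natDegree) * Q.leadingCoeff = 0 := by
            rw [← this, Polynomial.leadingCoeff]; ring
          rw [d1]; push_cast
          simpa [cQ] using h6.symm
      · simp only [gen Q v d1] at h3
        rw [show (k : Polynomial K) * Q.derivative * v = k * (v * Q.derivative) by ring,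
          Polynomial.coeff_natCast_mul] at h3
        by_cases d2 : Q.natDegree = 0
        · rw [gen' Q Q d2] at h3
          simp [cQ, cv] at h3
          simp [h3, d2]
        · rw [add_comm, gen v Q d2] at h3
          have h6 : ((v.natDegree : K) - k * Q.natDegree) * (Q.leadingCoeff * v.leadingCoeff) = 0 := by
            linear_combination h3
          push_cast
          have := (mul_eq_zero.1 h6).resolve_right (mul_ne_zero cQ cv)
          linear_combination this
    rw [CharP.natCast_eq_natCast K p] at h4
    exact Nat.ModEq.eq_of_lt_of_lt h4 h2 hk
  by_cases hw0 : w = 0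
  · exact ⟨0, by simp [hw0]⟩
  have hd := key w hw0 h hw
  have cQ : Q.leadingCoeff ≠ 0 := by simpa using hQ
  set α := w.leadingCoeff / Q.leadingCoeff ^ k with hα
  refine ⟨α, ?_⟩
  by_contra hne
  have hne' : w - Polynomial.C α * Q ^ k ≠ 0 := sub_ne_zero.2 hne
  have hα0 : α ≠ 0 := div_ne_zero (by simpa using hw0) (pow_ne_zero _ cQ)
  have hpd : (Polynomial.C α * Q ^ k).natDegree = k * Q.natDegree := by
    rw [Polynomial.natDegree_C_mul hα0, Polynomial.natDegree_pow]
  have hle : (w - Polynomial.C α * Q ^ k).natDegree ≤ k * Q.natDegree :=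
    (Polynomial.natDegree_sub_le _ _).trans (by rw [hpd, hd]; simp)
  have := key _ hne' (by
    rw [Polynomial.derivative_sub, Polynomial.derivative_C_mul, Polynomial.derivative_pow, mul_sub, h]
    rcases k with _ | k
    · simp
    · simp only [Nat.add_sub_cancel, Polynomial.C_eq_natCast]; ring) (lt_of_le_of_lt hle hk)
  have hc : (w - Polynomial.C α * Q ^ k).coeff (k * Q.natDegree) = 0 := by
    rw [Polynomial.coeff_sub, Polynomial.coeff_C_mul, ← hd]
    have : (Q ^ k).coeff w.natDegree = Q.leadingCoeff ^ k := by
      rw [hd, ← Polynomial.natDegree_pow, Polynomial.coeff_natDegree, Polynomial.leadingCoeff_pow]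
    rw [this, Polynomial.coeff_natDegree, hα]
    field_simp; ring
  rw [← this, Polynomial.coeff_natDegree, Polynomial.leadingCoeff_eq_zero] at hc
  exact hne' hc

lemma PQ_lemma {K : Type*} [Field K] (p : ℕ) [CharP K p] (e : ℕ)
    (P Q : Polynomial K) (hQ : Q ≠ 0)
    (hPd : P.natDegree ≤ e) (hQd : Q.natDegree ≤ e) (he : 2 * e + 1 < p)
    (h : Q ^ 2 * (P * Q.derivative.derivative - Q * P.derivative.derivative) +
      2 * Q * Q.derivative * (Q * P.derivative - P * Q.derivative) = 0) :
    ∃ α β : K, P = (Polynomial.C α * Polynomial.X + Polynomial.C β) * Q := by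
  set w := Q * P.derivative - P * Q.derivative with hw
  have hw' : w.derivative = Q * P.derivative.derivative - P * Q.derivative.derivative := by
    simp only [hw, Polynomial.derivative_sub, Polynomial.derivative_mul]; ring
  have h1 : Q * w.derivative = ((2 : ℕ) : Polynomial K) * Q.derivative * w := by
    apply mul_left_cancel₀ hQ
    rw [hw']; push_cast
    linear_combination -h
  have hdP := Polynomial.natDegree_derivative_le P
  have hdQ := Polynomial.natDegree_derivative_le Q
  have hwd : w.natDegree ≤ 2 * e := by
    refine (Polynomial.natDegree_sub_le _ _).trans (max_le ?_ ?_)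
    · exact Polynomial.natDegree_mul_le.trans (by omega)
    · exact Polynomial.natDegree_mul_le.trans (by omega)
  obtain ⟨α, hα⟩ := ode_lemma p 2 Q w hQ h1 (by omega) (by omega)
  set P1 := P - Polynomial.C α * Polynomial.X * Q with hP1
  have h2 : Q * P1.derivative = ((1 : ℕ) : Polynomial K) * Q.derivative * P1 := by
    simp only [hP1, Polynomial.derivative_sub, Polynomial.derivative_mul, Polynomial.derivative_C,
      Polynomial.derivative_X]
    push_cast
    linear_combination hα
  have hP1d : P1.natDegree ≤ e + 1 := by
    refine (Polynomial.natDegree_sub_le _ _).trans (max_le (by omega) ?_)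
    refine Polynomial.natDegree_mul_le.trans ?_
    have := Polynomial.natDegree_C_mul_le α (Polynomial.X : Polynomial K)
    rw [Polynomial.natDegree_X] at this
    omega
  obtain ⟨β, hβ⟩ := ode_lemma p 1 Q P1 hQ h2 (by omega) (by omega)
  refine ⟨α, β, ?_⟩
  linear_combination hβ

lemma pderiv_comm' {K σ : Type*} [Field K] (i j : σ) (F : MvPolynomial σ K) :
    MvPolynomial.pderiv i (MvPolynomial.pderiv j F) =
      MvPolynomial.pderiv j (MvPolynomial.pderiv i F) := by
  classical
  induction F using MvPolynomial.induction_on with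
  | C a => simp
  | add p q hp hq => simp [hp, hq]
  | mul_X p k hp =>
    simp only [Derivation.leibniz, MvPolynomial.pderiv_X, smul_eq_mul, map_add, hp]
    have h : ∀ a b : σ, MvPolynomial.pderiv a (Pi.single (M := fun _ => MvPolynomial σ K) b 1 k) = 0 := by
      intro a b
      by_cases h : k = b
      · subst h; simp
      · simp [h]
    rw [h, h]
    ring

/-- restriction to a line parallel to the plane `x = const`. -/
noncomputable def rL {K : Type*} [Field K] (μ κ x : K) : MvPolynomial (Fin 3) K →ₐ[K] Polynomial K :=
  MvPolynomial.aeval ![Polynomial.C μ * Polynomial.X + Polynomial.C κ, Polynomial.C x, Polynomial.X]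

noncomputable def rM {K : Type*} [Field K] (ν ρ y : K) : MvPolynomial (Fin 3) K →ₐ[K] Polynomial K :=
  MvPolynomial.aeval ![Polynomial.C ν * Polynomial.X + Polynomial.C ρ, Polynomial.X, Polynomial.C y]

lemma rL_eval {K : Type*} [Field K] (μ κ x : K) (F : MvPolynomial (Fin 3) K) (t : K) :
    (rL μ κ x F).eval t = MvPolynomial.eval ![μ * t + κ, x, t] F := by
  rw [rL, eval_aeval']
  congr 2
  ext i; fin_cases i <;> simp

lemma rM_eval {K : Type*} [Field K] (μ κ x : K) (F : MvPolynomial (Fin 3) K) (t : K) :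
    (rM μ κ x F).eval t = MvPolynomial.eval ![μ * t + κ, t, x] F := by
  rw [rM, eval_aeval']
  congr 2
  ext i; fin_cases i <;> simp

lemma rL_natDegree {K : Type*} [Field K] (μ κ x : K) (F : MvPolynomial (Fin 3) K) :
    (rL μ κ x F).natDegree ≤ F.totalDegree := by
  refine (MvPolynomial.aeval_natDegree_le (n := 1) F le_rfl _ ?_).trans (by omega)
  intro i; fin_cases i
  · exact Polynomial.natDegree_linear_le (a := μ) (b := κ)
  · simp
  · simp

lemma rM_natDegree {K : Type*} [Field K] (μ κ x : K) (F : MvPolynomial (Fin 3) K) :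
    (rM μ κ x F).natDegree ≤ F.totalDegree := by
  refine (MvPolynomial.aeval_natDegree_le (n := 1) F le_rfl _ ?_).trans (by omega)
  intro i; fin_cases i
  · exact Polynomial.natDegree_linear_le (a := μ) (b := κ)
  · simp
  · simp

lemma rL_eq_zero {K : Type*} [Field K] [Infinite K] {μ κ x : K} {F : MvPolynomial (Fin 3) K} :
    rL μ κ x F = 0 ↔ ∀ t, MvPolynomial.eval ![μ * t + κ, x, t] F = 0 := by
  constructor
  · intro h t; rw [← rL_eval, h]; simp
  · intro h; apply Polynomial.funext; intro t; rw [rL_eval, h]; simp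

lemma rL_deriv {K : Type*} [Field K] (μ κ x : K) (F : MvPolynomial (Fin 3) K) :
    (rL μ κ x F).derivative =
      Polynomial.C μ * rL μ κ x (MvPolynomial.pderiv 0 F) + rL μ κ x (MvPolynomial.pderiv 2 F) := by
  induction F using MvPolynomial.induction_on with
  | C a => simp [rL]
  | add p q hp hq => simp only [map_add, hp, hq]; ring
  | mul_X p k hp =>
    simp only [map_mul, Derivation.leibniz, smul_eq_mul, map_add, hp, Polynomial.derivative_mul]
    fin_cases k <;> simp [rL, MvPolynomial.pderiv_X] <;> ring

lemma rM_deriv {K : Type*} [Field K] (μ κ x : K) (F : MvPolynomial (Fin 3) K) :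
    (rM μ κ x F).derivative =
      Polynomial.C μ * rM μ κ x (MvPolynomial.pderiv 0 F) + rM μ κ x (MvPolynomial.pderiv 1 F) := by
  induction F using MvPolynomial.induction_on with
  | C a => simp [rM]
  | add p q hp hq => simp only [map_add, hp, hq]; ring
  | mul_X p k hp =>
    simp only [map_mul, Derivation.leibniz, smul_eq_mul, map_add, hp, Polynomial.derivative_mul]
    fin_cases k <;> simp [rM, MvPolynomial.pderiv_X] <;> ring

lemma totalDegree_pderiv_le {K σ : Type*} [Field K] (i : σ) (F : MvPolynomial σ K) :
    (MvPolynomial.pderiv i F).totalDegree ≤ F.totalDegree - 1 := by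
  rw [MvPolynomial.totalDegree]
  apply Finset.sup_le
  intro m hm
  rw [MvPolynomial.mem_support_iff, MvPolynomial.coeff_pderiv] at hm
  have h1 : m + Finsupp.single i 1 ∈ F.support := by
    rw [MvPolynomial.mem_support_iff]; intro h; rw [h] at hm; simp at hm
  have h2 := MvPolynomial.le_totalDegree h1
  rw [Finsupp.sum_add_index'] at h2
  · simp at h2; 
    omega
  · simp
  · simp

/-- the flecnode-type polynomial -/
noncomputable def flec {K : Type*} [Field K] (F : MvPolynomial (Fin 3) K) : MvPolynomial (Fin 3) K :=
  MvPolynomial.pderiv 2 (MvPolynomial.pderiv 2 F) * MvPolynomial.pderiv 0 F ^ 2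
  - 2 * MvPolynomial.pderiv 0 (MvPolynomial.pderiv 2 F) * MvPolynomial.pderiv 2 F * MvPolynomial.pderiv 0 F
  + MvPolynomial.pderiv 0 (MvPolynomial.pderiv 0 F) * MvPolynomial.pderiv 2 F ^ 2

lemma flec_degree {K : Type*} [Field K] (F : MvPolynomial (Fin 3) K) :
    (flec F).totalDegree ≤ 3 * F.totalDegree := by
  have d0 := totalDegree_pderiv_le 0 F
  have d2 := totalDegree_pderiv_le 2 F
  have d22 := totalDegree_pderiv_le 2 (MvPolynomial.pderiv 2 F)
  have d02 := totalDegree_pderiv_le 0 (MvPolynomial.pderiv 2 F)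
  have d00 := totalDegree_pderiv_le 0 (MvPolynomial.pderiv 0 F)
  unfold flec
  refine (MvPolynomial.totalDegree_add _ _).trans (max_le ((MvPolynomial.totalDegree_sub _ _).trans (max_le ?_ ?_)) ?_)
  · refine (MvPolynomial.totalDegree_mul _ _).trans ?_
    have := MvPolynomial.totalDegree_pow (MvPolynomial.pderiv 0 F) 2
    omega
  · refine (MvPolynomial.totalDegree_mul _ _).trans ?_
    have := MvPolynomial.totalDegree_mul (2 * MvPolynomial.pderiv 0 (MvPolynomial.pderiv 2 F)) (MvPolynomial.pderiv 2 F)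
    have h3 := MvPolynomial.totalDegree_mul (2 : MvPolynomial (Fin 3) K) (MvPolynomial.pderiv 0 (MvPolynomial.pderiv 2 F))
    have h4 : (2 : MvPolynomial (Fin 3) K).totalDegree = 0 := by
      have : (2 : MvPolynomial (Fin 3) K) = MvPolynomial.C 2 := (map_ofNat MvPolynomial.C 2).symm
      rw [this, MvPolynomial.totalDegree_C]
    omega
  · refine (MvPolynomial.totalDegree_mul _ _).trans ?_
    have := MvPolynomial.totalDegree_pow (MvPolynomial.pderiv 2 F) 2
    omega

lemma flec_vanish {K : Type*} [Field K] {μ κ x : K} {F : MvPolynomial (Fin 3) K}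
    (h : rL μ κ x F = 0) : rL μ κ x (flec F) = 0 := by
  have h1 := rL_deriv μ κ x F
  have h2 := rL_deriv μ κ x (MvPolynomial.pderiv 0 F)
  have h3 := rL_deriv μ κ x (MvPolynomial.pderiv 2 F)
  have h4 := congrArg Polynomial.derivative h1
  rw [h] at h1 h4
  simp only [Polynomial.derivative_add, Polynomial.derivative_mul, Polynomial.derivative_C, h2, h3,
    Polynomial.derivative_zero] at h1 h4
  rw [pderiv_comm' 2 0] at h4
  simp only [flec, map_add, map_sub, map_mul, map_pow, map_ofNat]
  set a := rL μ κ x (MvPolynomial.pderiv 0 F)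
  set b := rL μ κ x (MvPolynomial.pderiv 2 F)
  have hb : b = - (Polynomial.C μ * a) := by linear_combination -h1
  rw [hb]
  linear_combination -a^2 * h4

lemma flec_V {K : Type*} [Field K] {μ κ x : K} {F : MvPolynomial (Fin 3) K}
    (h : rL μ κ x F = 0) (hdiv : F ∣ flec F) :
    let P := - rL μ κ x (MvPolynomial.pderiv 1 F)
    let Q := rL μ κ x (MvPolynomial.pderiv 0 F)
    Q ^ 2 * (P * Q.derivative.derivative - Q * P.derivative.derivative) +
      2 * Q * Q.derivative * (Q * P.derivative - P * Q.derivative) = 0 := by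
  intro P Q
  have hV : rL μ κ x (MvPolynomial.pderiv 0 F * MvPolynomial.pderiv 1 (flec F)
      - MvPolynomial.pderiv 1 F * MvPolynomial.pderiv 0 (flec F)) = 0 := by
    obtain ⟨H, hH⟩ := hdiv
    rw [hH]
    simp only [Derivation.leibniz, smul_eq_mul, map_sub, map_mul, map_add, h]
    ring
  have h1 := rL_deriv μ κ x F
  have h2 := rL_deriv μ κ x (MvPolynomial.pderiv 0 F)
  have h3 := rL_deriv μ κ x (MvPolynomial.pderiv 2 F)
  have h4 := congrArg Polynomial.derivative h1
  rw [h] at h1 h4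
  simp only [Polynomial.derivative_add, Polynomial.derivative_mul, Polynomial.derivative_C, h2, h3,
    Polynomial.derivative_zero] at h1 h4
  rw [pderiv_comm' 2 0] at h4
  have hP1 : P.derivative = - (Polynomial.C μ * rL μ κ x (MvPolynomial.pderiv 0 (MvPolynomial.pderiv 1 F)) + rL μ κ x (MvPolynomial.pderiv 2 (MvPolynomial.pderiv 1 F))) := by
    simp only [P, Polynomial.derivative_neg, rL_deriv]
  have hQ1 : Q.derivative = Polynomial.C μ * rL μ κ x (MvPolynomial.pderiv 0 (MvPolynomial.pderiv 0 F)) + rL μ κ x (MvPolynomial.pderiv 2 (MvPolynomial.pderiv 0 F)) := by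
    simp only [Q, rL_deriv]
  rw [hP1, hQ1]
  simp only [Polynomial.derivative_add, Polynomial.derivative_mul, Polynomial.derivative_C,
    Polynomial.derivative_neg, rL_deriv]
  simp only [flec, map_add, map_sub, Derivation.leibniz, Derivation.leibniz_pow, smul_eq_mul, map_mul, map_pow, map_ofNat] at hV
  rw [pderiv_comm' 1 2 (MvPolynomial.pderiv 2 F), pderiv_comm' 1 2 F, pderiv_comm' 1 0 F,
    pderiv_comm' 1 0 (MvPolynomial.pderiv 2 F), pderiv_comm' 1 0 (MvPolynomial.pderiv 0 F),
    pderiv_comm' 1 2 F, pderiv_comm' 1 0 F, pderiv_comm' 0 2 (MvPolynomial.pderiv 2 F), pderiv_comm' 0 2 F,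
    pderiv_comm' 0 2 (MvPolynomial.pderiv 0 F)] at hV
  rw [pderiv_comm' 0 2 (MvPolynomial.pderiv 1 F), pderiv_comm' 0 2 (MvPolynomial.pderiv 0 F)]
  rw [pderiv_comm' 0 2 F] at h4
  have hD2 : ∀ i : Fin 3, MvPolynomial.pderiv i (2 : MvPolynomial (Fin 3) K) = 0 := by
    intro i
    rw [show (2 : MvPolynomial (Fin 3) K) = MvPolynomial.C 2 from (map_ofNat MvPolynomial.C 2).symm,
      MvPolynomial.pderiv_C]
  simp only [hD2, map_zero, nsmul_eq_mul, map_mul, map_natCast, pow_one, Nat.add_sub_cancel,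
    Nat.reduceSub, Nat.cast_ofNat, map_ofNat] at hV
  simp only [P, Q]
  have hb : rL μ κ x (MvPolynomial.pderiv 2 F) = - (Polynomial.C μ * rL μ κ x (MvPolynomial.pderiv 0 F)) := by
    linear_combination -h1
  rw [hb] at hV
  have hc : rL μ κ x (MvPolynomial.pderiv 2 (MvPolynomial.pderiv 2 F)) = - (Polynomial.C μ * rL μ κ x (MvPolynomial.pderiv 2 (MvPolynomial.pderiv 0 F))) - Polynomial.C μ * (Polynomial.C μ * rL μ κ x (MvPolynomial.pderiv 0 (MvPolynomial.pderiv 0 F)) + rL μ κ x (MvPolynomial.pderiv 2 (MvPolynomial.pderiv 0 F))) := by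
    linear_combination -h4
  rw [hc] at hV
  rw [pderiv_comm' 0 2 (MvPolynomial.pderiv 1 F)] at hV
  linear_combination hV

lemma FZ_ne {K ι : Type*} [Field K] [Infinite K] (p : ℕ) [CharP K p] [DecidableEq ι]
    (F : MvPolynomial (Fin 3) K) (hF : F ≠ 0) (hp : F.totalDegree < p)
    (S : Finset ι) (f μ κ : ι → K) (hf : Set.InjOn f S)
    (hS : ∀ i ∈ S, rL (μ i) (κ i) (f i) F = 0) (hc : F.totalDegree < S.card) :
    MvPolynomial.pderiv 0 F ≠ 0 := by
  intro h0
  have hm : ∀ m ∈ F.support, m 0 = 0 := by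
    intro m hm
    by_contra hne
    have h1 := MvPolynomial.coeff_pderiv (i := (0 : Fin 3)) F (m - Finsupp.single 0 1)
    rw [h0, MvPolynomial.coeff_zero] at h1
    have h2 : m - Finsupp.single 0 1 + Finsupp.single 0 1 = m := by
      apply tsub_add_cancel_of_le
      simp; omega
    rw [h2] at h1
    have h3 : F.coeff m ≠ 0 := MvPolynomial.mem_support_iff.1 hm
    have h4 : ((m 0 : ℕ) : K) = 0 := by
      have h5 : (m - Finsupp.single 0 1 : Fin 3 →₀ ℕ) 0 + 1 = m 0 := by
        simp; omega
      rw [← h5]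
      push_cast
      rcases mul_eq_zero.1 h1.symm with h | h
      · exact absurd h h3
      · exact h
    rw [CharP.cast_eq_zero_iff K p] at h4
    have h6 : m 0 ≤ F.totalDegree :=
      (MvPolynomial.monomial_le_degreeOf 0 hm).trans (MvPolynomial.degreeOf_le_totalDegree _ _)
    have := Nat.le_of_dvd (by omega) h4
    omega
  have hind : ∀ z z' x y : K, MvPolynomial.eval ![z,x,y] F = MvPolynomial.eval ![z',x,y] F := by
    intro z z' x y
    rw [MvPolynomial.eval_eq', MvPolynomial.eval_eq']
    apply Finset.sum_congr rfl
    intro m hm'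
    simp [Fin.prod_univ_three, hm m hm']
  have : ∃ v : Fin 3 → K, MvPolynomial.eval v F ≠ 0 := by
    by_contra hcon
    push Not at hcon
    exact hF (MvPolynomial.funext fun v => by simp [hcon v])
  obtain ⟨v, hv⟩ := this
  have := card_le_of_root (rM 0 (v 0) (v 2) F) (by
    intro h
    have h1 := rM_eval 0 (v 0) (v 2) F (v 1)
    rw [h, Polynomial.eval_zero] at h1
    apply hv
    rw [h1]
    congr 2
    ext i; fin_cases i <;> simp) S f hf (by
    intro i hi
    rw [rM_eval, hind _ (μ i * v 2 + κ i), ← rL_eval, hS i hi]; simp) _ (rM_natDegree _ _ _ _)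
  omega

lemma structure_lemma {K ι : Type*} [Field K] [Infinite K] (p : ℕ) [CharP K p] [DecidableEq ι]
    (F : MvPolynomial (Fin 3) K) (hF : Irreducible F) (e : ℕ) (he : F.totalDegree = e) (he1 : 1 ≤ e)
    (hp : 2 * e + 1 < p)
    (S : Finset ι) (f μ κ : ι → K) (hf : Set.InjOn f S)
    (hS : ∀ i ∈ S, rL (μ i) (κ i) (f i) F = 0) (hc : 12 * e ^ 2 < S.card) :
    ∃ T ⊆ S, S.card ≤ T.card + 12 * e ^ 2 ∧ ∀ i ∈ T, ∃ α β : K, ∃ Q : Polynomial K, Q ≠ 0 ∧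
      Q.natDegree ≤ e ∧ ∀ ν ρ y, rM ν ρ y F = 0 → ν * f i + ρ = μ i * y + κ i → Q.eval y ≠ 0 →
        ν = α * y + β := by
  classical
  have hee : e ≤ 12 * e ^ 2 := by nlinarith
  have hZ := FZ_ne p F hF.ne_zero (by omega) S f μ κ hf hS (by omega)
  have hdeg : F.degreeOf 0 ≠ 0 := by
    intro h
    apply hZ
    apply MvPolynomial.pderiv_eq_zero_of_notMem_vars
    rw [MvPolynomial.mem_vars_iff_mem_support]
    rintro ⟨m, hm, h0⟩
    have := MvPolynomial.monomial_le_degreeOf 0 hm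
    simp at h0; omega
  have hS' : ∀ i ∈ S, ∀ y, MvPolynomial.eval ![μ i * y + κ i, f i, y] F = 0 :=
    fun i hi => rL_eq_zero.1 (hS i hi)
  have hdiv : F ∣ flec F := by
    by_contra hnd
    have := bezout_lite F (flec F) e hF hdeg hnd he.le (he ▸ flec_degree F) S f μ κ hf hS'
      (fun i hi => rL_eq_zero.1 (flec_vanish (hS i hi)))
    omega
  have hdZ := totalDegree_pderiv_le 0 F
  have hdX := totalDegree_pderiv_le 1 F
  have hnd : ¬ F ∣ MvPolynomial.pderiv 0 F := by
    rintro ⟨H, hH⟩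
    have hH0 : H ≠ 0 := by rintro rfl; simp at hH; exact hZ hH
    have := MvPolynomial.totalDegree_mul_of_isDomain hF.ne_zero hH0
    rw [← hH] at this
    omega
  refine ⟨S.filter (fun i => rL (μ i) (κ i) (f i) (MvPolynomial.pderiv 0 F) ≠ 0),
    Finset.filter_subset _ _, ?_, ?_⟩
  · have h1 := bezout_lite F (MvPolynomial.pderiv 0 F) e hF hdeg hnd he.le (by omega)
      (S.filter (fun i => ¬ rL (μ i) (κ i) (f i) (MvPolynomial.pderiv 0 F) ≠ 0)) f μ κ
      (hf.mono (Finset.coe_subset.2 (Finset.filter_subset _ _))) (fun i hi => hS' i (Finset.mem_filter.1 hi).1)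
      (fun i hi => rL_eq_zero.1 (not_not.1 (Finset.mem_filter.1 hi).2))
    have h2 := Finset.card_filter_add_card_filter_not (s := S)
      (fun i => rL (μ i) (κ i) (f i) (MvPolynomial.pderiv 0 F) ≠ 0)
    omega
  · intro i hi
    obtain ⟨hiS, hQ⟩ := Finset.mem_filter.1 hi
    have hV := flec_V (hS i hiS) hdiv
    have hPd := rL_natDegree (μ i) (κ i) (f i) (MvPolynomial.pderiv 1 F)
    have hQd := rL_natDegree (μ i) (κ i) (f i) (MvPolynomial.pderiv 0 F)
    obtain ⟨α, β, hαβ⟩ := PQ_lemma p e _ _ hQ (by rw [Polynomial.natDegree_neg]; omega) (by omega) hp hV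
    refine ⟨α, β, _, hQ, by omega, ?_⟩
    intro ν ρ y hm hinc hQy
    have h1 := rM_deriv ν ρ y F
    rw [hm, Polynomial.derivative_zero] at h1
    have h2 := congrArg (Polynomial.eval (f i)) h1
    have h3 := congrArg (Polynomial.eval y) hαβ
    simp only [Polynomial.eval_add, Polynomial.eval_mul, Polynomial.eval_C, Polynomial.eval_neg,
      Polynomial.eval_X, Polynomial.eval_zero, rM_eval, rL_eval, hinc] at h2 h3
    rw [rL_eval] at hQy
    apply mul_right_cancel₀ hQy
    linear_combination -h2 + h3

lemma exists_F {K ι : Type*} [Field K] (d : ℕ) (M : Finset ι) (g ν ρ : ι → K)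
    (h : M.card * (3 * d + 1) < (d + 1) ^ 3) :
    ∃ F : MvPolynomial (Fin 3) K, F ≠ 0 ∧ F.totalDegree ≤ 3 * d ∧
      ∀ j ∈ M, rM (ν j) (ρ j) (g j) F = 0 := by
  classical
  let mm : (Fin 3 → Fin (d + 1)) → (Fin 3 →₀ ℕ) :=
    fun s => Finsupp.equivFunOnFinite.symm (fun i => (s i : ℕ))
  have hmm : Function.Injective mm := by
    intro s t hst
    ext i
    have := DFunLike.congr_fun hst i
    simpa [mm] using this
  let Fc : ((Fin 3 → Fin (d + 1)) → K) →ₗ[K] MvPolynomial (Fin 3) K :=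
    ∑ s, (MvPolynomial.monomial (mm s)) ∘ₗ LinearMap.proj s
  have hFc : ∀ c, Fc c = ∑ s, MvPolynomial.monomial (mm s) (c s) := by
    intro c; simp [Fc]
  let L : ((Fin 3 → Fin (d + 1)) → K) →ₗ[K] (M × Fin (3 * d + 1) → K) :=
    LinearMap.pi fun jt => (Polynomial.lcoeff K (jt.2 : ℕ)) ∘ₗ
      (rM (ν jt.1) (ρ jt.1) (g jt.1)).toLinearMap ∘ₗ Fc
  have hker : LinearMap.ker L ≠ ⊥ := by
    apply LinearMap.ker_ne_bot_of_finrank_lt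
    simpa using h
  obtain ⟨c, hc, hc0⟩ := Submodule.exists_mem_ne_zero_of_ne_bot hker
  have hdeg : (Fc c).totalDegree ≤ 3 * d := by
    rw [hFc]
    refine (MvPolynomial.totalDegree_finsetSum _ _).trans (Finset.sup_le fun s _ => ?_)
    refine (MvPolynomial.totalDegree_monomial_le _ _).trans ?_
    rw [Finsupp.sum_fintype _ _ (by simp)]
    have h0 := (s 0).2; have h1 := (s 1).2; have h2 := (s 2).2
    simp [Fin.sum_univ_three, mm]; omega
  refine ⟨Fc c, ?_, hdeg, ?_⟩
  · intro h0
    apply hc0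
    ext s
    have := congrArg (MvPolynomial.coeff (mm s)) h0
    rw [hFc, MvPolynomial.coeff_sum] at this
    simp only [MvPolynomial.coeff_monomial, hmm.eq_iff, Finset.sum_ite_eq', Finset.mem_univ,
      if_true, MvPolynomial.coeff_zero] at this
    simpa using this
  · intro j hj
    ext t
    by_cases ht : t < 3 * d + 1
    · have := congrFun (LinearMap.mem_ker.1 hc) (⟨j, hj⟩, ⟨t, ht⟩)
      simpa [L] using this
    · rw [Polynomial.coeff_zero]
      apply Polynomial.coeff_eq_zero_of_natDegree_lt
      have := rM_natDegree (ν j) (ρ j) (g j) (Fc c)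
      omega

lemma cover {ι ι' : Type*} [DecidableEq ι] [DecidableEq ι'] (I : Finset ι) (J : Finset ι')
    (r : ι → ι' → Prop) [∀ i j, Decidable (r i j)] (Δ d : ℕ) (hΔ0 : 0 < Δ) (hI : 0 < I.card)
    (hΔ : ∀ i ∈ I, Δ ≤ (J.filter (r i)).card) (hd : 2 * d ≤ Δ) :
    ∃ M ⊆ J, M.card * Δ ≤ 4 * J.card * (d + 1) ∧
      I.card ≤ 2 * (I.filter fun i => d + 1 ≤ (M.filter (r i)).card).card := by
  let Φ : Finset ι' → ℤ := fun M =>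
    4 * J.card * (∑ i ∈ I, min (M.filter (r i)).card (d + 1) : ℕ) - I.card * Δ * M.card
  obtain ⟨M, hM, hmax⟩ := Finset.exists_max_image J.powerset Φ ⟨∅, by simp⟩
  rw [Finset.mem_powerset] at hM
  refine ⟨M, hM, ?_, ?_⟩
  · have h0 := hmax ∅ (by simp)
    simp only [Φ, Finset.filter_empty, Finset.card_empty, Nat.zero_min, Finset.sum_const_zero] at h0
    have h1 : (∑ i ∈ I, min (M.filter (r i)).card (d + 1)) ≤ I.card * (d + 1) := by
      refine (Finset.sum_le_sum fun i _ => min_le_right _ _).trans ?_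
      simp
    have h2 : I.card * (M.card * Δ) ≤ I.card * (4 * J.card * (d + 1)) := by
      have h3 : (I.card * Δ * M.card : ℤ) ≤ 4 * J.card * (∑ i ∈ I, min (M.filter (r i)).card (d + 1) : ℕ) := by
        push_cast at h0 ⊢; linarith
      have h4 : I.card * Δ * M.card ≤ 4 * J.card * (∑ i ∈ I, min (M.filter (r i)).card (d + 1)) := by
        exact_mod_cast h3
      have h5 := Nat.mul_le_mul_left (4 * J.card) h1
      calc I.card * (M.card * Δ) = I.card * Δ * M.card := by ring
        _ ≤ _ := h4
        _ ≤ _ := h5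
        _ = _ := by ring
    exact Nat.le_of_mul_le_mul_left h2 hI
  · set bad := I.filter fun i => ¬ d + 1 ≤ (M.filter (r i)).card with hbad
    have hstep : ∀ j ∈ J \ M, 4 * J.card * (bad.filter fun i => r i j).card ≤ I.card * Δ := by
      intro j hj
      obtain ⟨hjJ, hjM⟩ := Finset.mem_sdiff.1 hj
      have h0 := hmax (insert j M) (by
        rw [Finset.mem_powerset]; exact Finset.insert_subset hjJ hM)
      have h1 : (∑ i ∈ I, min (M.filter (r i)).card (d + 1)) + (bad.filter fun i => r i j).card ≤
          ∑ i ∈ I, min ((insert j M).filter (r i)).card (d + 1) := by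
        rw [hbad, Finset.filter_filter, Finset.card_filter, ← Finset.sum_add_distrib]
        apply Finset.sum_le_sum
        intro i _
        rw [Finset.filter_insert]
        by_cases hr : r i j
        · rw [if_pos hr, Finset.card_insert_of_notMem (by simp [hjM])]
          split_ifs with h
          · have := h.1
            omega
          · simp only [add_zero]; omega
        · rw [if_neg hr, if_neg (by tauto)]
          simp
      simp only [Φ, Finset.card_insert_of_notMem hjM] at h0
      have h2 : (4 * J.card : ℤ) * (∑ i ∈ I, min (M.filter (r i)).card (d + 1) : ℕ) + 4 * J.card * (bad.filter fun i => r i j).card ≤ 4 * J.card * (∑ i ∈ I, min ((insert j M).filter (r i)).card (d + 1) : ℕ) := by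
        rw [← mul_add]
        apply mul_le_mul_of_nonneg_left _ (by positivity)
        exact_mod_cast h1
      have h3 : (4 * J.card : ℤ) * (bad.filter fun i => r i j).card ≤ I.card * Δ := by
        push_cast at h0 h2 ⊢
        linarith
      exact_mod_cast h3
    have hdc : ∑ j ∈ J \ M, (bad.filter fun i => r i j).card =
        ∑ i ∈ bad, ((J \ M).filter fun j => r i j).card := by
      simp only [Finset.card_filter]
      exact Finset.sum_comm
    have hlow : ∀ i ∈ bad, Δ ≤ ((J \ M).filter fun j => r i j).card + d := by
      intro i hi
      obtain ⟨hiI, hi2⟩ := Finset.mem_filter.1 hi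
      have h1 := hΔ i hiI
      have h2 : (J.filter (r i)) ⊆ ((J \ M).filter fun j => r i j) ∪ M.filter (r i) := by
        intro j hj
        simp only [Finset.mem_filter, Finset.mem_union, Finset.mem_sdiff] at hj ⊢
        tauto
      have h3 := (Finset.card_le_card h2).trans (Finset.card_union_le _ _)
      omega
    have hs1 : bad.card * Δ ≤ 2 * ∑ i ∈ bad, ((J \ M).filter fun j => r i j).card := by
      rw [Finset.mul_sum, ← smul_eq_mul, ← Finset.sum_const]
      apply Finset.sum_le_sum
      intro i hi
      have := hlow i hi
      omega
    have hs2 : 4 * J.card * ∑ j ∈ J \ M, (bad.filter fun i => r i j).card ≤ J.card * (I.card * Δ) := by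
      rw [Finset.mul_sum]
      refine (Finset.sum_le_sum hstep).trans ?_
      rw [Finset.sum_const, smul_eq_mul]
      exact Nat.mul_le_mul_right _ (Finset.card_le_card Finset.sdiff_subset)
    have hJ : 0 < J.card := by
      obtain ⟨i, hi⟩ := Finset.card_pos.1 hI
      have := hΔ i hi
      have := Finset.card_filter_le J (r i)
      omega
    have hfin : 2 * bad.card ≤ I.card := by
      rw [hdc] at hs2
      have h1 : (J.card * Δ) * (2 * bad.card) ≤ (J.card * Δ) * I.card := by
        calc (J.card * Δ) * (2 * bad.card) = 2 * J.card * (bad.card * Δ) := by ring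
          _ ≤ 2 * J.card * (2 * ∑ i ∈ bad, ((J \ M).filter fun j => r i j).card) := by gcongr
          _ = 4 * J.card * ∑ i ∈ bad, ((J \ M).filter fun j => r i j).card := by ring
          _ ≤ _ := hs2
          _ = _ := by ring
      exact Nat.le_of_mul_le_mul_left h1 (by positivity)
    have := Finset.card_filter_add_card_filter_not (s := I) (fun i => d + 1 ≤ (M.filter (r i)).card)
    rw [← hbad] at this
    omega

/-- reduction to an irreducible polynomial -/
lemma exists_irred {K ι : Type*} [Field K] [Infinite K] [DecidableEq ι]
    (I : Finset ι) (f μ κ : ι → K) (d : ℕ) (hI : 0 < I.card)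
    (F0 : MvPolynomial (Fin 3) K) (hF0 : F0 ≠ 0) (hd : F0.totalDegree ≤ d)
    (I0 : Finset ι) (hI0 : I0 ⊆ I) (hcard : I.card ≤ 2 * I0.card)
    (hv : ∀ i ∈ I0, rL (μ i) (κ i) (f i) F0 = 0) :
    ∃ F : MvPolynomial (Fin 3) K, Irreducible F ∧ 1 ≤ F.totalDegree ∧ F.totalDegree ≤ d ∧
      ∃ S ⊆ I, (∀ i ∈ S, rL (μ i) (κ i) (f i) F = 0) ∧
        (∀ i ∈ I, rL (μ i) (κ i) (f i) F = 0 → i ∈ S) ∧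
        I.card * F.totalDegree ≤ S.card * (2 * d) := by
  classical
  let S : MvPolynomial (Fin 3) K → Finset ι := fun F => I.filter fun i => rL (μ i) (κ i) (f i) F = 0
  let P : ℕ → Prop := fun e => ∃ F : MvPolynomial (Fin 3) K, F ≠ 0 ∧ F.totalDegree = e ∧ 1 ≤ e ∧
    I.card * e ≤ (S F).card * (2 * d)
  have hP : P F0.totalDegree := by
    refine ⟨F0, hF0, rfl, ?_, ?_⟩
    · by_contra h
      have h0 : F0.totalDegree = 0 := by omega
      rw [MvPolynomial.totalDegree_eq_zero_iff_eq_C] at h0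
      have : 0 < I0.card := by omega
      obtain ⟨i, hi⟩ := Finset.card_pos.1 this
      have h1 := hv i hi
      rw [h0] at h1
      have h2 : MvPolynomial.coeff 0 F0 = 0 := by simpa [rL] using h1
      rw [h2] at h0
      exact hF0 (by simpa using h0)
    · have h1 : I0 ⊆ S F0 := by
        intro i hi
        exact Finset.mem_filter.2 ⟨hI0 hi, hv i hi⟩
      have h2 := Finset.card_le_card h1
      calc I.card * F0.totalDegree ≤ (2 * (S F0).card) * d := by gcongr; omega
        _ = _ := by ring
  have hex : ∃ e, P e := ⟨_, hP⟩
  obtain ⟨F, hFne, hFe, he1, hFS⟩ := Nat.find_spec hex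
  have hmin : ∀ e, P e → Nat.find hex ≤ e := fun e he => Nat.find_min' hex he
  set e := Nat.find hex with he
  refine ⟨F, ?_, by omega, hFe.le.trans ((hmin _ hP).trans hd), S F, Finset.filter_subset _ _,
    fun i hi => (Finset.mem_filter.1 hi).2, fun i hi h => Finset.mem_filter.2 ⟨hi, h⟩, by rw [hFe]; exact hFS⟩
  constructor
  · intro hu
    have := (MvPolynomial.isUnit_iff_totalDegree_of_isReduced.1 hu).2
    omega
  · intro G H hGH
    by_contra hcon
    push Not at hcon
    have hG0 : G ≠ 0 := by rintro rfl; simp at hGH; exact hFne hGH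
    have hH0 : H ≠ 0 := by rintro rfl; simp at hGH; exact hFne hGH
    have hdeg := MvPolynomial.totalDegree_mul_of_isDomain hG0 hH0
    rw [← hGH, hFe] at hdeg
    have hnu : ∀ U : MvPolynomial (Fin 3) K, U ≠ 0 → ¬ IsUnit U → 1 ≤ U.totalDegree := by
      intro U hU0 hU
      by_contra h
      have h0 : U.totalDegree = 0 := by omega
      apply hU
      rw [MvPolynomial.isUnit_iff_totalDegree_of_isReduced]
      refine ⟨?_, h0⟩
      rw [MvPolynomial.totalDegree_eq_zero_iff_eq_C] at h0
      rw [isUnit_iff_ne_zero]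
      intro h2
      rw [h2] at h0
      exact hU0 (by simpa using h0)
    have hG1 := hnu G hG0 hcon.1
    have hH1 := hnu H hH0 hcon.2
    have hGP : ¬ P G.totalDegree := fun h => by have := hmin _ h; omega
    have hHP : ¬ P H.totalDegree := fun h => by have := hmin _ h; omega
    have hG2 : (S G).card * (2 * d) < I.card * G.totalDegree := by
      by_contra h; push Not at h
      exact hGP ⟨G, hG0, rfl, hG1, h⟩
    have hH2 : (S H).card * (2 * d) < I.card * H.totalDegree := by
      by_contra h; push Not at h
      exact hHP ⟨H, hH0, rfl, hH1, h⟩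
    have hsub : S F ⊆ S G ∪ S H := by
      intro i hi
      obtain ⟨hiI, h0⟩ := Finset.mem_filter.1 hi
      rw [hGH, map_mul, mul_eq_zero] at h0
      rw [Finset.mem_union]
      rcases h0 with h | h
      · exact Or.inl (Finset.mem_filter.2 ⟨hiI, h⟩)
      · exact Or.inr (Finset.mem_filter.2 ⟨hiI, h⟩)
    have h5 := (Finset.card_le_card hsub).trans (Finset.card_union_le _ _)
    have : I.card * e < I.card * e := by
      calc I.card * e ≤ (S F).card * (2 * d) := hFS
        _ ≤ ((S G).card + (S H).card) * (2 * d) := by gcongr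
        _ < I.card * e := by rw [hdeg]; linarith
    omega

lemma PP {K ι ι' : Type*} [Field K] [Infinite K] (p : ℕ) [CharP K p] [DecidableEq ι] [DecidableEq ι']
    [DecidableEq K]
    (I : Finset ι) (J : Finset ι') (f μ κ : ι → K) (g ν ρ : ι' → K)
    (hf : Set.InjOn f I) (hg : Set.InjOn g J) (Δ k' : ℕ)
    (hΔ : ∀ i ∈ I, Δ ≤ (J.filter fun j => μ i * g j + κ i = ν j * f i + ρ j).card)
    (hk : ∀ α β γ δ : K, (J.filter fun j => ν j = α * g j + β ∧ ρ j = γ * g j + δ).card ≤ k')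
    (h1 : 1000000 * J.card ≤ Δ ^ 2) (h2 : 1000000 * k' ≤ Δ) (h3 : 1000000 * J.card ≤ Δ * p) :
    I.card * Δ ^ 2 ≤ 1000000 * J.card ^ 2 := by
  by_contra hcon
  push Not at hcon
  have hI : 0 < I.card := by
    by_contra h
    have : I.card = 0 := by omega
    rw [this] at hcon; simp at hcon
  have hΔ0 : 0 < Δ := by
    rcases Nat.eq_zero_or_pos Δ with h | h
    · rw [h] at hcon; simp at hcon
    · exact h
  obtain ⟨i0, hi0⟩ := Finset.card_pos.1 hI
  have hJΔ : Δ ≤ J.card := (hΔ i0 hi0).trans (Finset.card_filter_le _ _)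
  set n := J.card with hn
  set d' := 36 * n / Δ with hd'
  have hd'1 : d' * Δ ≤ 36 * n := Nat.div_mul_le_self _ _
  have hd'2 : 36 * n < (d' + 1) * Δ := by
    have := Nat.lt_div_mul_add (a := 36 * n) hΔ0
    rw [← hd'] at this
    linarith [this, add_mul d' 1 Δ]
  have hd'pos : 36 ≤ d' := by
    rw [hd', Nat.le_div_iff_mul_le hΔ0]; omega
  set d := 3 * d' with hd
  have hdΔ : 100 * d ≤ Δ := by
    have : (100 * d) * Δ ≤ Δ * Δ := by
      calc (100 * d) * Δ = 300 * (d' * Δ) := by rw [hd]; ring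
        _ ≤ 300 * (36 * n) := by gcongr
        _ ≤ 1000000 * n := by omega
        _ ≤ Δ * Δ := by rw [← sq]; exact h1
    exact Nat.le_of_mul_le_mul_right this hΔ0
  have hdp : 100 * d ≤ p := by
    have : (100 * d) * Δ ≤ p * Δ := by
      calc (100 * d) * Δ = 300 * (d' * Δ) := by rw [hd]; ring
        _ ≤ 300 * (36 * n) := by gcongr
        _ ≤ 1000000 * n := by omega
        _ ≤ p * Δ := by rw [mul_comm p]; exact h3
    exact Nat.le_of_mul_le_mul_right this hΔ0
  have hdI : 80 * d ^ 2 ≤ I.card := by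
    have : (80 * d ^ 2) * Δ ^ 2 ≤ I.card * Δ ^ 2 := by
      calc (80 * d ^ 2) * Δ ^ 2 = 720 * (d' * Δ) ^ 2 := by rw [hd]; ring
        _ ≤ 720 * (36 * n) ^ 2 := by gcongr
        _ ≤ 1000000 * n ^ 2 := by nlinarith [sq_nonneg n]
        _ ≤ I.card * Δ ^ 2 := hcon.le
    exact Nat.le_of_mul_le_mul_right this (by positivity)
  obtain ⟨M, hMJ, hMcard, hMI⟩ := cover I J (fun i j => μ i * g j + κ i = ν j * f i + ρ j) Δ d hΔ0 hI hΔ (by omega)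
  obtain ⟨F0, hF0, hF0d, hF0v⟩ := exists_F d' M g ν ρ (by
    have : (M.card * (3 * d' + 1)) * Δ < (d' + 1) ^ 3 * Δ := by
      calc (M.card * (3 * d' + 1)) * Δ = (M.card * Δ) * (3 * d' + 1) := by ring
        _ ≤ (4 * n * (d + 1)) * (3 * d' + 1) := by gcongr
        _ = 4 * n * (3 * d' + 1) ^ 2 := by rw [hd]; ring
        _ ≤ 4 * n * (3 * (d' + 1)) ^ 2 := by gcongr; omega
        _ = (36 * n) * (d' + 1) ^ 2 := by ring
        _ < ((d' + 1) * Δ) * (d' + 1) ^ 2 := by gcongr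
        _ = _ := by ring
    exact Nat.lt_of_mul_lt_mul_right this)
  obtain ⟨F, hFirr, hFe1, hFd, S, hSI, hSv, hSall, hScard⟩ := exists_irred I f μ κ d hI F0 hF0 hF0d
    _ (Finset.filter_subset _ _) hMI (by
      intro i hi
      obtain ⟨hiI, hdeg⟩ := Finset.mem_filter.1 hi
      by_contra hne
      have := card_le_of_root _ hne (M.filter fun j => μ i * g j + κ i = ν j * f i + ρ j) g
        (hg.mono (by
          intro j hj
          exact hMJ (Finset.mem_filter.1 (Finset.mem_coe.1 hj)).1)) (by
          intro j hj
          obtain ⟨hjM, hj⟩ := Finset.mem_filter.1 hj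
          rw [rL_eval, hj, ← rM_eval, hF0v j hjM, Polynomial.eval_zero]) d
        ((rL_natDegree _ _ _ _).trans hF0d)
      omega)
  set e := F.totalDegree with he
  have hSe : 40 * e ^ 2 ≤ S.card := by
    have : (40 * e ^ 2) * (2 * d) ≤ S.card * (2 * d) := by
      calc (40 * e ^ 2) * (2 * d) = 80 * d * e * e := by ring
        _ ≤ 80 * d * d * e := by gcongr
        _ = 80 * d ^ 2 * e := by ring
        _ ≤ I.card * e := by gcongr
        _ ≤ _ := hScard
    exact Nat.le_of_mul_le_mul_right this (by omega)
  have hee : 1 ≤ e ^ 2 := Nat.one_le_pow _ _ hFe1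
  obtain ⟨T, hTS, hTcard, hT⟩ := structure_lemma p F hFirr e rfl hFe1 (by omega) S f μ κ
    (hf.mono (Finset.coe_subset.2 hSI)) hSv (by omega)
  -- each `i ∈ T` has many neighbours off `F`
  set J1 := J.filter fun j => rM (ν j) (ρ j) (g j) F = 0 with hJ1
  set J2 := J.filter fun j => ¬ rM (ν j) (ρ j) (g j) F = 0 with hJ2
  have hdeg2 : ∀ i ∈ T, Δ ≤ 2 * (J2.filter fun j => μ i * g j + κ i = ν j * f i + ρ j).card := by
    intro i hi
    obtain ⟨α, β, Q, hQ0, hQd, hQ⟩ := hT i hi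
    have hcov : (J.filter fun j => μ i * g j + κ i = ν j * f i + ρ j) ⊆
        (J2.filter fun j => μ i * g j + κ i = ν j * f i + ρ j) ∪
        ((J.filter fun j => Q.eval (g j) = 0) ∪
        (J.filter fun j => ν j = α * g j + β ∧ ρ j = (μ i - α * f i) * g j + (κ i - β * f i))) := by
      intro j hj
      obtain ⟨hjJ, hinc⟩ := Finset.mem_filter.1 hj
      simp only [Finset.mem_union, Finset.mem_filter, hJ2]
      by_cases h4 : rM (ν j) (ρ j) (g j) F = 0
      · by_cases h5 : Q.eval (g j) = 0
        · tauto
        · have h6 := hQ _ _ _ h4 hinc.symm h5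
          right; right
          refine ⟨hjJ, h6, ?_⟩
          have : ρ j = μ i * g j + κ i - ν j * f i := by rw [hinc]; ring
          rw [this, h6]; ring
      · tauto
    have c1 := (Finset.card_le_card hcov).trans (Finset.card_union_le _ _)
    have c2 := Finset.card_union_le (J.filter fun j => Q.eval (g j) = 0)
        (J.filter fun j => ν j = α * g j + β ∧ ρ j = (μ i - α * f i) * g j + (κ i - β * f i))
    have c3 := hk α β (μ i - α * f i) (κ i - β * f i)
    have c4 := card_le_of_root Q hQ0 (J.filter fun j => Q.eval (g j) = 0) g
      (hg.mono (Finset.coe_subset.2 (Finset.filter_subset _ _)))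
      (fun j hj => (Finset.mem_filter.1 hj).2) e hQd
    have c5 := hΔ i (hSI (hTS hi))
    omega
  have hdeg3 : ∀ j ∈ J2, (T.filter fun i => μ i * g j + κ i = ν j * f i + ρ j).card ≤ e := by
    intro j hj
    obtain ⟨hjJ, hne⟩ := Finset.mem_filter.1 hj
    refine card_le_of_root _ hne _ f (hf.mono ?_) ?_ e (rM_natDegree _ _ _ _)
    · intro i hi
      exact hSI (hTS (Finset.mem_filter.1 (Finset.mem_coe.1 hi)).1)
    · intro i hi
      obtain ⟨hiT, hinc⟩ := Finset.mem_filter.1 hi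
      rw [rM_eval, ← hinc, ← rL_eval, hSv i (hTS hiT), Polynomial.eval_zero]
  have hdc : ∑ i ∈ T, (J2.filter fun j => μ i * g j + κ i = ν j * f i + ρ j).card =
      ∑ j ∈ J2, (T.filter fun i => μ i * g j + κ i = ν j * f i + ρ j).card := by
    simp only [Finset.card_filter]; exact Finset.sum_comm
  have hlow : T.card * Δ ≤ 2 * ∑ i ∈ T, (J2.filter fun j => μ i * g j + κ i = ν j * f i + ρ j).card := by
    rw [Finset.mul_sum, ← smul_eq_mul, ← Finset.sum_const]
    exact Finset.sum_le_sum hdeg2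
  have hup : ∑ j ∈ J2, (T.filter fun i => μ i * g j + κ i = ν j * f i + ρ j).card ≤ n * e := by
    refine (Finset.sum_le_sum hdeg3).trans ?_
    rw [Finset.sum_const, smul_eq_mul]
    exact Nat.mul_le_mul_right _ (Finset.card_le_card (Finset.filter_subset _ _))
  rw [hdc] at hlow
  have hTΔ : T.card * Δ ≤ 2 * (n * e) := by omega
  have hST : S.card ≤ 2 * T.card := by omega
  have hfin : I.card * Δ ≤ 8 * (n * d) := by
    have : (I.card * Δ) * e ≤ (8 * (n * d)) * e := by
      calc (I.card * Δ) * e = (I.card * e) * Δ := by ring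
        _ ≤ (S.card * (2 * d)) * Δ := by gcongr
        _ ≤ (2 * T.card * (2 * d)) * Δ := by gcongr
        _ = 4 * d * (T.card * Δ) := by ring
        _ ≤ 4 * d * (2 * (n * e)) := by gcongr
        _ = _ := by ring
    exact Nat.le_of_mul_le_mul_right this hFe1
  have : I.card * Δ ^ 2 ≤ 1000000 * n ^ 2 := by
    calc I.card * Δ ^ 2 = (I.card * Δ) * Δ := by ring
      _ ≤ (8 * (n * d)) * Δ := by gcongr
      _ = 24 * n * (d' * Δ) := by rw [hd]; ring
      _ ≤ 24 * n * (36 * n) := by gcongr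
      _ = 864 * n ^ 2 := by ring
      _ ≤ _ := by gcongr; norm_num
  omega

lemma layer {ι : Type*} [DecidableEq ι] (s : Finset ι) (h : ι → ℕ) (T : ℕ) (hT : 1 ≤ T) (W : ℝ)
    (hW : ∀ t, T ≤ t → ((s.filter fun i => t ≤ h i).card : ℝ) * (t : ℝ) ^ 2 ≤ W) :
    (∑ i ∈ s.filter (fun i => T ≤ h i), h i : ℝ) ≤ 2 * W / T := by
  have hTr : (1 : ℝ) ≤ T := by exact_mod_cast hT
  have hW0 : 0 ≤ W := le_trans (by positivity) (hW T le_rfl)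
  set s' := s.filter (fun i => T ≤ h i) with hs'
  have key : ∀ U : ℕ, T ≤ U → (∑ i ∈ s', (min (h i) U : ℕ) : ℝ) ≤ 2 * W / T - W / U := by
    intro U hU
    induction U, hU using Nat.le_induction with
    | base =>
      have h1 : (∑ i ∈ s', (min (h i) T : ℕ) : ℝ) = s'.card * T := by
        rw [Finset.sum_congr rfl (g := fun _ => (T : ℝ))]
        · simp
        · intro i hi
          rw [min_eq_right (Finset.mem_filter.1 hi).2]
      rw [h1]
      have h2 := hW T le_rfl
      rw [show 2 * W / T - W / T = W / T by ring, le_div_iff₀ (by positivity)]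
      calc (s'.card : ℝ) * T * T = s'.card * (T : ℝ) ^ 2 := by ring
        _ ≤ W := h2
    | succ U hU ih =>
      have hUr : (1 : ℝ) ≤ U := by exact_mod_cast hT.trans hU
      have h1 : (∑ i ∈ s', (min (h i) (U + 1) : ℕ) : ℝ) ≤ (∑ i ∈ s', (min (h i) U : ℕ) : ℝ) +
          ((s.filter fun i => U + 1 ≤ h i).card : ℝ) := by
        have h2 : (s.filter fun i => U + 1 ≤ h i) = s'.filter fun i => U + 1 ≤ h i := by
          rw [hs', Finset.filter_filter]
          apply Finset.filter_congr
          intro i _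
          constructor
          · intro h; omega
          · intro h; omega
        rw [h2]
        have h3 : ∑ i ∈ s', (min (h i) (U + 1)) ≤ (∑ i ∈ s', (min (h i) U)) + (s'.filter fun i => U + 1 ≤ h i).card := by
          rw [Finset.card_filter, ← Finset.sum_add_distrib]
          apply Finset.sum_le_sum
          intro i _
          split_ifs <;> omega
        exact_mod_cast h3
      have h2 := hW (U + 1) (by omega)
      have h3 : ((s.filter fun i => U + 1 ≤ h i).card : ℝ) ≤ W / U - W / (U + 1) := by
        push_cast at h2
        have h4 : W / U - W / (U + 1) = W / (U * (U + 1)) := by field_simp; ring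
        rw [h4, le_div_iff₀ (by positivity)]
        refine le_trans ?_ h2
        gcongr
        nlinarith
      push_cast at h1 ih ⊢
      linarith
  have h1 := key (T + ∑ i ∈ s', h i) (by omega)
  have h2 : (∑ i ∈ s', (min (h i) (T + ∑ i ∈ s', h i) : ℕ) : ℝ) = ∑ i ∈ s', (h i : ℝ) := by
    apply Finset.sum_congr rfl
    intro i hi
    rw [min_eq_left]
    have := Finset.single_le_sum (f := h) (fun _ _ => Nat.zero_le _) hi
    omega
  rw [h2] at h1
  have : 0 ≤ W / ((T + ∑ i ∈ s', h i : ℕ) : ℝ) := by positivity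
  linarith

/-- The collinearity bound. -/
lemma collin {p : ℕ} [Fact p.Prime] {K : Type*} [Field K] [Algebra (ZMod p) K] [DecidableEq K]
    (A1 A2 : Finset (ZMod p)) (a k : ℕ) (h1 : A1.card ≤ a) (h2 : A2.card ≤ a) (hk : 2 ≤ k) (hka : k ≤ a)
    (S : Finset (ZMod p × (ZMod p × ZMod p)))
    (hS1 : ∀ s ∈ S, s.1 ∈ A1)
    (hS : ∀ s ∈ S, k ≤ (A1.filter fun x => s.2.1 * x + s.2.2 ∈ A2).card)
    (a0 a1 m0 m1 c0 c1 : K)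
    (hpar : ∀ s ∈ S, ∃ t : K, algebraMap (ZMod p) K s.1 = a0 + a1 * t ∧
      algebraMap (ZMod p) K s.2.1 = m0 + m1 * t ∧ algebraMap (ZMod p) K s.2.2 = c0 + c1 * t) :
    S.card * (k - 1) ≤ a ^ 2 := by
  have hinj : Function.Injective (algebraMap (ZMod p) K) := (algebraMap (ZMod p) K).injective
  by_cases hd : Set.InjOn (fun s : ZMod p × (ZMod p × ZMod p) => s.1) S
  · have : S.card ≤ A1.card := Finset.card_le_card_of_injOn _ hS1 hd
    calc S.card * (k - 1) ≤ a * a := by gcongr <;> omega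
      _ = a ^ 2 := by ring
  · simp only [Set.InjOn, not_forall] at hd
    obtain ⟨s1, hs1, s2, hs2, he, hne⟩ := hd
    obtain ⟨t1, e1, e2, e3⟩ := hpar s1 hs1
    obtain ⟨t2, f1, f2, f3⟩ := hpar s2 hs2
    have htne : t1 ≠ t2 := by
      rintro rfl
      apply hne
      refine Prod.ext he (Prod.ext ?_ ?_) <;> apply hinj
      · rw [e2, f2]
      · rw [e3, f3]
    have ha1 : a1 = 0 := by
      have : a1 * (t1 - t2) = 0 := by
        rw [he] at e1
        linear_combination f1 - e1
      exact (mul_eq_zero.1 this).resolve_right (sub_ne_zero.2 htne)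
    have hmc : m1 ≠ 0 ∨ c1 ≠ 0 := by
      by_contra hcon
      push Not at hcon
      apply hne
      refine Prod.ext he (Prod.ext ?_ ?_) <;> apply hinj
      · rw [e2, f2, hcon.1]; ring
      · rw [e3, f3, hcon.2]; ring
    -- count
    let X := fun s : ZMod p × (ZMod p × ZMod p) => A1.filter fun x =>
      s.2.1 * x + s.2.2 ∈ A2 ∧ m1 * algebraMap (ZMod p) K x + c1 ≠ 0
    have hX : ∀ s ∈ S, k - 1 ≤ (X s).card := by
      intro s hs
      have hsub : (A1.filter fun x => s.2.1 * x + s.2.2 ∈ A2) ⊆ X s ∪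
          (A1.filter fun x => m1 * algebraMap (ZMod p) K x + c1 = 0) := by
        intro x hx
        simp only [X, Finset.mem_filter, Finset.mem_union] at hx ⊢
        tauto
      have h3 := (Finset.card_le_card hsub).trans (Finset.card_union_le _ _)
      have h4 : (A1.filter fun x => m1 * algebraMap (ZMod p) K x + c1 = 0).card ≤ 1 := by
        rw [Finset.card_le_one]
        intro x hx y hy
        have hx := (Finset.mem_filter.1 hx).2
        have hy := (Finset.mem_filter.1 hy).2
        by_cases hm : m1 = 0
        · exfalso
          rw [hm] at hx
          simp at hx
          tauto
        · apply hinj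
          apply mul_left_cancel₀ hm
          linear_combination hx - hy
      have := hS s hs
      omega
    have hcard : ((S.sigma X).card) ≤ (A1 ×ˢ A2).card := by
      apply Finset.card_le_card_of_injOn (fun sx => (sx.2, sx.1.2.1 * sx.2 + sx.1.2.2))
      · intro sx hsx
        have hsx := Finset.mem_sigma.1 (Finset.mem_coe.1 hsx)
        have h4 := Finset.mem_filter.1 hsx.2
        exact Finset.mem_coe.2 (Finset.mem_product.2 ⟨h4.1, h4.2.1⟩)
      · rintro ⟨s, x⟩ hs ⟨s', x'⟩ hs' heq
        have hs := Finset.mem_sigma.1 (Finset.mem_coe.1 hs)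
        have hs' := Finset.mem_sigma.1 (Finset.mem_coe.1 hs')
        simp only [Prod.mk.injEq] at heq
        obtain ⟨hxx, heq⟩ := heq
        subst hxx
        have h4 := (Finset.mem_filter.1 hs.2).2.2
        simp only at h4
        obtain ⟨t, g1, g2, g3⟩ := hpar s hs.1
        obtain ⟨t', g1', g2', g3'⟩ := hpar s' hs'.1
        have h5 : t = t' := by
          have h6 := congrArg (algebraMap (ZMod p) K) heq
          simp only [map_add, map_mul, g2, g3, g2', g3'] at h6
          have h7 : (t - t') * (m1 * algebraMap (ZMod p) K x + c1) = 0 := by linear_combination h6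
          exact sub_eq_zero.1 ((mul_eq_zero.1 h7).resolve_right h4)
        subst h5
        have : s = s' := by
          refine Prod.ext ?_ (Prod.ext ?_ ?_) <;> apply hinj
          · rw [g1, g1']
          · rw [g2, g2']
          · rw [g3, g3']
        rw [this]
    rw [Finset.card_sigma, Finset.card_product] at hcard
    calc S.card * (k - 1) = ∑ s ∈ S, (k - 1) := by simp
      _ ≤ ∑ s ∈ S, (X s).card := Finset.sum_le_sum hX
      _ ≤ A1.card * A2.card := hcard
      _ ≤ a * a := by gcongr
      _ = a ^ 2 := by ring

lemma exists_generic {p : ℕ} [Fact p.Prime] {K : Type*} [Field K] [Algebra (ZMod p) K] [Infinite K] :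
    ∃ u v : K, (∀ m : ZMod p, 1 + v * algebraMap (ZMod p) K m ≠ 0) ∧ v ≠ 0 ∧
      Function.Injective (fun s : ZMod p × (ZMod p × ZMod p) =>
        (algebraMap (ZMod p) K s.1 + u * algebraMap (ZMod p) K s.2.1 + v * algebraMap (ZMod p) K s.2.2) /
          (1 + v * algebraMap (ZMod p) K s.2.1)) := by
  classical
  set φ := algebraMap (ZMod p) K with hφ
  have hinj : Function.Injective φ := φ.injective
  obtain ⟨v, hv⟩ := Infinite.exists_notMem_finset (Finset.univ.image φ)
  have hv' : ∀ x, v ≠ φ x := by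
    intro x hx; apply hv; simp [hx]
  obtain ⟨u, hu⟩ := Infinite.exists_notMem_finset
    (Finset.univ.image fun t : (ZMod p × (ZMod p × ZMod p)) × (ZMod p × (ZMod p × ZMod p)) =>
      ((φ t.2.1 + v * φ t.2.2.2) * (1 + v * φ t.1.2.1) - (φ t.1.1 + v * φ t.1.2.2) * (1 + v * φ t.2.2.1)) /
        (φ t.1.2.1 - φ t.2.2.1))
  have hu' : ∀ s t : ZMod p × (ZMod p × ZMod p), u ≠ ((φ t.1 + v * φ t.2.2) * (1 + v * φ s.2.1) - (φ s.1 + v * φ s.2.2) * (1 + v * φ t.2.1)) /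
        (φ s.2.1 - φ t.2.1) := by
    intro s t h
    apply hu
    exact Finset.mem_image.2 ⟨(s, t), Finset.mem_univ _, h.symm⟩
  have hV : ∀ m : ZMod p, 1 + v * φ m ≠ 0 := by
    intro m hm
    have hm0 : m ≠ 0 := by rintro rfl; simp at hm
    have hm1 : φ m ≠ 0 := by rwa [Ne, map_eq_zero_iff φ hinj]
    apply hv' (-m⁻¹)
    rw [map_neg, map_inv₀]
    field_simp
    linear_combination hm
  refine ⟨u, v, hV, by intro h; exact hv' 0 (by simp [h]), ?_⟩
  rintro ⟨a, m, c⟩ ⟨a', m', c'⟩ h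
  simp only at h
  rw [div_eq_div_iff (hV m) (hV m')] at h
  by_cases hm : m = m'
  · subst hm
    have h2 := mul_right_cancel₀ (hV m) h
    have hc : c = c' := by
      by_contra hc
      have hc1 : φ c - φ c' ≠ 0 := sub_ne_zero.2 (fun h => hc (hinj h))
      apply hv' ((a' - a) / (c - c'))
      rw [map_div₀, map_sub, map_sub]
      field_simp
      linear_combination h2
    subst hc
    have : a = a' := by apply hinj; linear_combination h2
    rw [this]
  · exfalso
    have hm1 : φ m - φ m' ≠ 0 := sub_ne_zero.2 (fun h => hm (hinj h))
    apply hu' (a, m, c) (a', m', c')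
    simp only
    field_simp
    linear_combination h

lemma rl_arith (a k L s : ℝ) (ha : 1 ≤ a) (hk : 2 ≤ k) (hka : k ≤ a) (hL : 0 ≤ L) (hs : 0 ≤ s) (hs2 : s ^ 2 = a * L)
    (r : ℝ) (hr : 3 * 10 ^ 6 * a ^ 2 * r ≤ k ^ 2 * L / 4)
    (h : k ^ 2 * L ≤ 3 * a ^ 2 * (10 ^ 6 * (3 * a ^ 2 / k + s + r))) :
    k ^ 4 * L ≤ 10 ^ 14 * a ^ 5 := by
  have hk0 : 0 < k := by linarith
  have ha0 : 0 < a := by linarith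
  have e1 : k ^ 2 * L * (3 / 4) ≤ 3 * 10 ^ 6 * a ^ 2 * (3 * a ^ 2 / k) + 3 * 10 ^ 6 * a ^ 2 * s := by
    linarith
  have e2 : (k ^ 2 * s) ^ 2 * (3 / 4) ≤ 9 * 10 ^ 6 * a ^ 5 * k + 3 * 10 ^ 6 * a ^ 3 * (k ^ 2 * s) := by
    have := mul_le_mul_of_nonneg_left e1 (show 0 ≤ a * k ^ 2 by positivity)
    calc (k ^ 2 * s) ^ 2 * (3 / 4) = a * k ^ 2 * (k ^ 2 * L * (3 / 4)) := by rw [mul_pow, hs2]; ring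
      _ ≤ _ := this
      _ = _ := by field_simp; ring
  have e3 : 3 * 10 ^ 6 * a ^ 3 * (k ^ 2 * s) ≤ (k ^ 2 * s) ^ 2 / 4 + 9 * 10 ^ 12 * a ^ 6 := by
    nlinarith [sq_nonneg ((k ^ 2 * s) / 2 - 3 * 10 ^ 6 * a ^ 3)]
  have e4 : 9 * 10 ^ 6 * a ^ 5 * k ≤ 9 * 10 ^ 6 * a ^ 6 := by
    have : a ^ 5 * k ≤ a ^ 5 * a := by gcongr
    nlinarith
  have e5 : (k ^ 2 * s) ^ 2 = a * (k ^ 4 * L) := by rw [mul_pow, hs2]; ring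
  have e6 : 0 ≤ a ^ 6 := by positivity
  have e7 : a * (k ^ 4 * L) ≤ a * (10 ^ 14 * a ^ 5) := by
    rw [← e5]; nlinarith
  exact le_of_mul_le_mul_left e7 ha0

lemma rl_deg {p : ℕ} [Fact p.Prime] (K : Type) [Field K] [Infinite K] [Algebra (ZMod p) K] [CharP K p] (A1 A2 : Finset (ZMod p)) (a k : ℕ) (h1 : A1.card ≤ a) (h2 : A2.card ≤ a)
    (hk : 2 ≤ k) (hka : k ≤ a) (L : Finset (ZMod p × ZMod p))
    (hL : ∀ l ∈ L, k ≤ (A1.filter fun x => l.1 * x + l.2 ∈ A2).card) (t : ℕ)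
    (ht1 : 1000000 * (A1 ×ˢ L).card ≤ t ^ 2) (ht2 : 1000000 * (a ^ 2 / (k - 1)) ≤ t)
    (ht3 : 1000000 * (A1 ×ˢ L).card ≤ t * p) :
    ((A1 ×ˢ L).filter fun i => t ≤ ((A1 ×ˢ L).filter fun j => i.2.1 * j.1 + i.2.2 = j.2.1 * i.1 + j.2.2).card).card
      * t ^ 2 ≤ 1000000 * (A1 ×ˢ L).card ^ 2 := by
  classical
  obtain ⟨u, v, hV, hv, hinj⟩ := exists_generic (p := p) (K := K)
  set φ := algebraMap (ZMod p) K with hφ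
  have hφi : Function.Injective φ := φ.injective
  let F : ZMod p × (ZMod p × ZMod p) → K := fun s => (φ s.1 + u * φ s.2.1 + v * φ s.2.2) / (1 + v * φ s.2.1)
  let M : ZMod p × (ZMod p × ZMod p) → K := fun s => φ s.2.1 / (1 + v * φ s.2.1)
  let R : ZMod p × (ZMod p × ZMod p) → K := fun s => φ s.2.2 / (1 + v * φ s.2.1)
  refine PP (K := K) p _ _ F M R F M R (hinj.injOn) (hinj.injOn) t (a ^ 2 / (k - 1)) ?_ ?_ ht1 ht2 ht3
  · intro i hi
    refine (Finset.mem_filter.1 hi).2.trans (Finset.card_le_card ?_)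
    intro j hj
    rw [Finset.mem_filter] at hj ⊢
    refine ⟨hj.1, ?_⟩
    have h3 := congrArg φ hj.2
    simp only [map_add, map_mul] at h3
    simp only [M, F, R]
    have hh1 := hV i.2.1
    have hh2 := hV j.2.1
    generalize hVi : 1 + v * φ i.2.1 = Vi at *
    generalize hVj : 1 + v * φ j.2.1 = Vj at *
    field_simp
    rw [← hVi, ← hVj]
    linear_combination h3
  · intro α β γ δ
    rw [Nat.le_div_iff_mul_le (by omega)]
    have key : ∀ s : ZMod p × (ZMod p × ZMod p), (M s = α * F s + β ∧ R s = γ * F s + δ) →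
        φ s.2.1 = α * (φ s.1 + u * φ s.2.1 + v * φ s.2.2) + β * (1 + v * φ s.2.1) ∧
        φ s.2.2 = γ * (φ s.1 + u * φ s.2.1 + v * φ s.2.2) + δ * (1 + v * φ s.2.1) := by
      intro s hs
      have h0 := hV s.2.1
      obtain ⟨h3, h4⟩ := hs
      simp only [M, F, R] at h3 h4
      rw [div_eq_iff h0, add_mul, mul_assoc, div_mul_cancel₀ _ h0] at h3 h4
      exact ⟨h3, h4⟩
    have hS1 : ∀ s ∈ (A1 ×ˢ L).filter (fun j => M j = α * F j + β ∧ R j = γ * F j + δ), s.1 ∈ A1 := by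
      intro s hs
      exact (Finset.mem_product.1 (Finset.mem_filter.1 hs).1).1
    have hS2 : ∀ s ∈ (A1 ×ˢ L).filter (fun j => M j = α * F j + β ∧ R j = γ * F j + δ),
        k ≤ (A1.filter fun x => s.2.1 * x + s.2.2 ∈ A2).card := by
      intro s hs
      exact hL _ (Finset.mem_product.1 (Finset.mem_filter.1 hs).1).2
    by_cases hb : 1 - v * β = 0
    · -- W fixed, parameter V
      by_cases hα : α = 0
      · have : (A1 ×ˢ L).filter (fun j => M j = α * F j + β ∧ R j = γ * F j + δ) = ∅ := by
          rw [Finset.filter_eq_empty_iff]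
          intro s hs hcon
          obtain ⟨h3, h4⟩ := key s hcon
          have : (1 : K) = 0 := by
            rw [hα] at h3
            linear_combination -v * h3 + (1 + v * φ s.2.1) * hb
          exact one_ne_zero this
        rw [this]; simp
      · set W : K := - 1 / (v * α) with hW
        -- m = (V-1)/v, c = γ W + δ V, a = W - u m - v c
        refine collin (K := K) A1 A2 a k h1 h2 hk hka _ hS1 hS2
          (W + u / v - v * γ * W) (- u / v - v * δ) (-1 / v) (1 / v) (γ * W) δ ?_
        intro s hs
        obtain ⟨h3, h4⟩ := key s (Finset.mem_filter.1 hs).2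
        have hWs : φ s.1 + u * φ s.2.1 + v * φ s.2.2 = W := by
          rw [hW, eq_div_iff (mul_ne_zero hv hα)]
          linear_combination -v * h3 + (1 + v * φ s.2.1) * hb
        refine ⟨1 + v * φ s.2.1, ?_, ?_, ?_⟩
        · rw [hWs] at h4
          field_simp
          linear_combination v * hWs - v^2 * h4
        · field_simp; ring
        · rw [hWs] at h4; exact h4.trans (by ring)
    · -- V = (1 + v α W)/(1 - vβ)
      refine collin (K := K) A1 A2 a k h1 h2 hk hka _ hS1 hS2
          (- u * (β / (1 - v * β)) - v * (δ / (1 - v * β)))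
          (1 - u * (α + β * (v * α / (1 - v * β))) - v * (γ + δ * (v * α / (1 - v * β))))
          (β / (1 - v * β)) (α + β * (v * α / (1 - v * β)))
          (δ / (1 - v * β)) (γ + δ * (v * α / (1 - v * β))) ?_
      intro s hs
      obtain ⟨h3, h4⟩ := key s (Finset.mem_filter.1 hs).2
      set W : K := φ s.1 + u * φ s.2.1 + v * φ s.2.2 with hW
      have hVs : 1 + v * φ s.2.1 = 1 / (1 - v * β) + v * α / (1 - v * β) * W := by
        field_simp
        linear_combination v * h3
      rw [hVs] at h3 h4
      refine ⟨W, ?_, ?_, ?_⟩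
      · have : φ s.1 = W - u * φ s.2.1 - v * φ s.2.2 := by rw [hW]; ring
        rw [this, h3, h4]; ring
      · rw [h3]; ring
      · rw [h4]; ring

lemma rl_Q {p : ℕ} [Fact p.Prime] (A1 A2 : Finset (ZMod p)) (k : ℕ)
    (L : Finset (ZMod p × ZMod p))
    (hL : ∀ l ∈ L, k ≤ (A1.filter fun x => l.1 * x + l.2 ∈ A2).card) :
    (k * L.card) ^ 2 ≤ A2.card * ∑ i ∈ A1 ×ˢ L, ((A1 ×ˢ L).filter fun j => i.2.1 * j.1 + i.2.2 = j.2.1 * i.1 + j.2.2).card := by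
  classical
  let N : ZMod p → Finset (ZMod p × (ZMod p × ZMod p)) := fun y => (A1 ×ˢ L).filter fun s => s.2.1 * s.1 + s.2.2 = y
  have e1 : k * L.card ≤ ∑ y ∈ A2, (N y).card := by
    calc k * L.card = ∑ l ∈ L, k := by simp [mul_comm]
      _ ≤ ∑ l ∈ L, (A1.filter fun x => l.1 * x + l.2 ∈ A2).card := Finset.sum_le_sum hL
      _ = (L.sigma fun l => (A1.filter fun x => l.1 * x + l.2 ∈ A2)).card := (Finset.card_sigma _ _).symm
      _ ≤ (A2.sigma N).card := by
          apply Finset.card_le_card_of_injOn (fun s => ⟨s.1.1 * s.2 + s.1.2, (s.2, s.1)⟩)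
          · intro s hs
            have hs := Finset.mem_sigma.1 (Finset.mem_coe.1 hs)
            have h4 := Finset.mem_filter.1 hs.2
            refine Finset.mem_coe.2 (Finset.mem_sigma.2 ⟨h4.2, ?_⟩)
            simp only [N, Finset.mem_filter, Finset.mem_product]
            exact ⟨⟨h4.1, hs.1⟩, trivial⟩
          · rintro ⟨l, x⟩ _ ⟨l', x'⟩ _ h
            simp at h
            obtain ⟨_, h⟩ := h
            simp_all
      _ = _ := Finset.card_sigma _ _
  have e2 : ∑ y ∈ A2, (N y).card ^ 2 ≤ ∑ i ∈ A1 ×ˢ L, ((A1 ×ˢ L).filter fun j => i.2.1 * j.1 + i.2.2 = j.2.1 * i.1 + j.2.2).card := by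
    calc ∑ y ∈ A2, (N y).card ^ 2 = ∑ y ∈ A2, (N y ×ˢ N y).card := by
          simp [Finset.card_product, sq]
      _ = (A2.sigma fun y => N y ×ˢ N y).card := (Finset.card_sigma _ _).symm
      _ ≤ ((A1 ×ˢ L).sigma fun i => (A1 ×ˢ L).filter fun j => i.2.1 * j.1 + i.2.2 = j.2.1 * i.1 + j.2.2).card := by
          apply Finset.card_le_card_of_injOn (fun s => ⟨(s.2.2.1, s.2.1.2), (s.2.1.1, s.2.2.2)⟩)
          · rintro ⟨y, s, s'⟩ hs
            simp only [N, Finset.mem_coe, Finset.mem_sigma, Finset.mem_filter, Finset.mem_product] at hs ⊢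
            obtain ⟨hy, ⟨⟨q1, q2⟩, q3⟩, ⟨q4, q5⟩, q6⟩ := hs
            exact ⟨⟨q4, q2⟩, ⟨q1, q5⟩, q3.trans q6.symm⟩
          · rintro ⟨y, ⟨x, l⟩, ⟨x', l'⟩⟩ hs ⟨z, ⟨w, m⟩, ⟨w', m'⟩⟩ ht h
            simp only [N, Finset.mem_coe, Finset.mem_sigma, Finset.mem_filter, Finset.mem_product] at hs ht
            simp only [Sigma.mk.injEq, Prod.mk.injEq, heq_eq_eq] at h
            obtain ⟨⟨rfl, rfl⟩, ⟨rfl, rfl⟩⟩ := h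
            have : y = z := hs.2.1.2.symm.trans ht.2.1.2
            subst this
            rfl
      _ = _ := Finset.card_sigma _ _
  calc (k * L.card) ^ 2 ≤ (∑ y ∈ A2, (N y).card) ^ 2 := by gcongr
    _ ≤ A2.card * ∑ y ∈ A2, (N y).card ^ 2 := sq_sum_le_card_mul_sum_sq
    _ ≤ _ := by gcongr

set_option maxHeartbeats 400000 in
lemma rich_lines {p : ℕ} [Fact p.Prime] (A1 A2 : Finset (ZMod p)) (a k : ℕ) (h1 : A1.card ≤ a) (h2 : A2.card ≤ a)
    (hk : 2 ≤ k) (hkp : 10 ^ 14 * a ^ 3 ≤ k ^ 2 * p) (L : Finset (ZMod p × ZMod p))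
    (hL : ∀ l ∈ L, k ≤ (A1.filter fun x => l.1 * x + l.2 ∈ A2).card) :
    (k : ℝ) ^ 4 * L.card ≤ 10 ^ 14 * (a : ℝ) ^ 5 := by
  classical
  rcases L.eq_empty_or_nonempty with rfl | hne
  · simp
  have hka : k ≤ a := by
    obtain ⟨l, hl⟩ := hne
    exact (hL l hl).trans ((Finset.card_filter_le _ _).trans h1)
  have hp : 0 < p := (Fact.out : p.Prime).pos
  set deg : ZMod p × (ZMod p × ZMod p) → ℕ := fun i => ((A1 ×ˢ L).filter fun j => i.2.1 * j.1 + i.2.2 = j.2.1 * i.1 + j.2.2).card with hdeg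
  obtain ⟨n, hn⟩ : ∃ n, n = (A1 ×ˢ L).card := ⟨_, rfl⟩
  obtain ⟨q1, hq1⟩ : ∃ q, q = a ^ 2 / (k - 1) := ⟨_, rfl⟩
  obtain ⟨q2, hq2⟩ : ∃ q, q = n / p := ⟨_, rfl⟩
  obtain ⟨T, hT⟩ : ∃ T : ℕ, T = 1000000 * (q1 + (Nat.sqrt n + 1) + (q2 + 1)) := ⟨_, rfl⟩
  have hT1 : 1 ≤ T := by omega
  have hsq : n ≤ (Nat.sqrt n + 1) ^ 2 := by
    have := Nat.lt_succ_sqrt n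
    simp only [Nat.succ_eq_add_one] at this
    nlinarith
  have hTn : 1000000 * n ≤ T ^ 2 := by
    have : 1000000 * (Nat.sqrt n + 1) ≤ T := by omega
    calc 1000000 * n ≤ 1000000 * (Nat.sqrt n + 1) ^ 2 := by gcongr
      _ ≤ (1000000 * (Nat.sqrt n + 1)) ^ 2 := by rw [mul_pow]; gcongr; norm_num
      _ ≤ T ^ 2 := by gcongr
  have hlay := layer (A1 ×ˢ L) deg T hT1 (1000000 * (n : ℝ) ^ 2) (by
    intro t ht
    have := rl_deg (AlgebraicClosure (ZMod p)) A1 A2 a k h1 h2 hk hka L hL t (hn ▸ hTn.trans (by gcongr)) (by rw [← hq1]; omega) (by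
      rw [← hn]
      calc 1000000 * n ≤ 1000000 * ((n / p + 1) * p) := by
            gcongr
            have := Nat.lt_div_mul_add (a := n) hp
            nlinarith
        _ = (1000000 * (n / p + 1)) * p := by ring
        _ ≤ t * p := by gcongr; rw [← hq2]; omega)
    rw [← hn] at this
    exact_mod_cast this)
  have hQ := rl_Q A1 A2 k L hL
  have hT0 : (0 : ℝ) < T := by
    exact_mod_cast hT1
  have hTn' : 1000000 * (n : ℝ) ≤ (T : ℝ) ^ 2 := by exact_mod_cast hTn
  have hsum : (∑ i ∈ A1 ×ˢ L, (deg i : ℝ)) ≤ 3 * n * T := by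
    rw [← Finset.sum_filter_add_sum_filter_not (A1 ×ˢ L) (fun i => T ≤ deg i)]
    have e1 : ∑ i ∈ (A1 ×ˢ L).filter (fun i => ¬ T ≤ deg i), (deg i : ℝ) ≤ n * T := by
      calc ∑ i ∈ (A1 ×ˢ L).filter (fun i => ¬ T ≤ deg i), (deg i : ℝ) ≤ ∑ i ∈ (A1 ×ˢ L).filter (fun i => ¬ T ≤ deg i), (T : ℝ) := by
            apply Finset.sum_le_sum
            intro i hi
            have := (Finset.mem_filter.1 hi).2
            exact_mod_cast (by omega : deg i ≤ T)
        _ ≤ n * T := by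
            rw [Finset.sum_const, nsmul_eq_mul]
            gcongr
            rw [hn]; exact Finset.card_filter_le _ _
    have e2 : 2 * (1000000 * (n : ℝ) ^ 2) / T ≤ 2 * n * T := by
      rw [div_le_iff₀ hT0]
      have : (0 : ℝ) ≤ n := by positivity
      nlinarith
    linarith
  have hLpos : (0 : ℝ) < L.card := by exact_mod_cast Finset.card_pos.2 hne
  have hkr : (2 : ℝ) ≤ k := by exact_mod_cast hk
  have hkar : (k : ℝ) ≤ a := by exact_mod_cast hka
  have ha1 : (1 : ℝ) ≤ a := by linarith
  have hpr : (0 : ℝ) < p := by exact_mod_cast hp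
  have hnr : (n : ℝ) ≤ a * L.card := by
    rw [hn, Finset.card_product]
    have : (A1.card : ℝ) ≤ a := by exact_mod_cast h1
    push_cast
    gcongr
  have hmain : (k : ℝ) ^ 2 * L.card ≤ 3 * a ^ 2 * T := by
    have hQ' : ((k : ℝ) * L.card) ^ 2 ≤ A2.card * ∑ i ∈ A1 ×ˢ L, (deg i : ℝ) := by exact_mod_cast hQ
    have h2' : (A2.card : ℝ) ≤ a := by exact_mod_cast h2
    have : ((k : ℝ) * L.card) ^ 2 ≤ a * (3 * (a * L.card) * T) := by
      refine hQ'.trans ?_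
      have h0 : (0 : ℝ) ≤ ∑ i ∈ A1 ×ˢ L, (deg i : ℝ) := Finset.sum_nonneg (fun _ _ => Nat.cast_nonneg _)
      refine mul_le_mul h2' (hsum.trans ?_) h0 (by positivity)
      gcongr
    apply le_of_mul_le_mul_right _ hLpos
    linarith
  set s := Real.sqrt (a * L.card) with hs
  have hs2 : s ^ 2 = a * L.card := Real.sq_sqrt (by positivity)
  have hs0 : 0 ≤ s := Real.sqrt_nonneg _
  have hk1 : (q1 : ℝ) ≤ 2 * a ^ 2 / k := by
    rw [hq1]
    refine Nat.cast_div_le.trans ?_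
    rw [Nat.cast_sub (by omega)]
    push_cast
    rw [div_le_div_iff₀ (by linarith) (by linarith)]
    nlinarith [sq_nonneg (a : ℝ)]
  have hsn : (Nat.sqrt n : ℝ) ≤ s := by
    apply Real.le_sqrt_of_sq_le
    refine le_trans ?_ hnr
    exact_mod_cast Nat.sqrt_le' n
  have hnp : (q2 : ℝ) ≤ a * L.card / p := by
    rw [hq2]
    refine Nat.cast_div_le.trans ?_
    gcongr
  have h2a : (2 : ℝ) ≤ a ^ 2 / k := by
    rw [le_div_iff₀ (by linarith)]
    nlinarith
  refine rl_arith a k L.card s ha1 hkr hkar hLpos.le hs0 hs2 (a * L.card / p) ?_ ?_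
  · have hkp' : 10 ^ 14 * (a : ℝ) ^ 3 ≤ k ^ 2 * p := by exact_mod_cast hkp
    have : 3 * 10 ^ 6 * (a : ℝ) ^ 2 * (a * L.card / p) = (3 * 10 ^ 6 * (a : ℝ) ^ 3) * L.card / p := by ring
    rw [this, div_le_iff₀ hpr]
    have h5 : 3 * 10 ^ 6 * (a : ℝ) ^ 3 ≤ k ^ 2 * p / 4 := by
      have : (0 : ℝ) ≤ a ^ 3 := by positivity
      nlinarith
    nlinarith
  · refine hmain.trans ?_
    gcongr
    rw [hT]
    push_cast
    have : 3 * (a : ℝ) ^ 2 / k = 2 * a ^ 2 / k + a ^ 2 / k := by ring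
    rw [this]
    linarith

/-- Incidence of a point `(x,y)` with the Moebius curve `s = (b,b',z)`. -/
def mobInc {p : ℕ} [Fact p.Prime] (lam : ZMod p) (s : ZMod p × (ZMod p × ZMod p)) (q : ZMod p × ZMod p) : Prop :=
  q.1 + s.1 ≠ 0 ∧ q.2 + s.2.1 ≠ 0 ∧ lam / (q.1 + s.1) - lam / (q.2 + s.2.1) = s.2.2

instance {p : ℕ} [Fact p.Prime] (lam : ZMod p) (s : ZMod p × (ZMod p × ZMod p)) :
    DecidablePred (mobInc lam s) := fun q => by unfold mobInc; infer_instance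

/-- Richness of the curve `s`. -/
def mobN {p : ℕ} [Fact p.Prime] (lam : ZMod p) (A : Finset (ZMod p)) (s : ZMod p × (ZMod p × ZMod p)) : ℕ :=
  ((A ×ˢ A).filter (mobInc lam s)).card

lemma mobInc_snd {p : ℕ} [Fact p.Prime] {lam : ZMod p} (hl : lam ≠ 0) {s : ZMod p × (ZMod p × ZMod p)}
    {x y y' : ZMod p} (h : mobInc lam s (x, y)) (h' : mobInc lam s (x, y')) : y = y' := by
  obtain ⟨h1, h2, h3⟩ := h
  obtain ⟨h1', h2', h3'⟩ := h'
  simp only at *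
  have : lam / (y + s.2.1) = lam / (y' + s.2.1) := by linear_combination h3' - h3
  rw [div_eq_div_iff h2 h2'] at this
  have := mul_left_cancel₀ hl this
  linear_combination -this

lemma mobInc_fst {p : ℕ} [Fact p.Prime] {lam : ZMod p} (hl : lam ≠ 0) {s : ZMod p × (ZMod p × ZMod p)}
    {x x' y : ZMod p} (h : mobInc lam s (x, y)) (h' : mobInc lam s (x', y)) : x = x' := by
  obtain ⟨h1, h2, h3⟩ := h
  obtain ⟨h1', h2', h3'⟩ := h'
  simp only at *
  have : lam / (x + s.1) = lam / (x' + s.1) := by linear_combination h3 - h3'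
  rw [div_eq_div_iff h1 h1'] at this
  have := mul_left_cancel₀ hl this
  linear_combination -this

lemma mobN_le {p : ℕ} [Fact p.Prime] {lam : ZMod p} (hl : lam ≠ 0) (A : Finset (ZMod p))
    (s : ZMod p × (ZMod p × ZMod p)) : mobN lam A s ≤ A.card := by
  apply Finset.card_le_card_of_injOn (fun q => q.1)
  · intro q hq
    exact (Finset.mem_product.1 (Finset.mem_filter.1 hq).1).1
  · rintro ⟨x, y⟩ hq ⟨x', y'⟩ hq' h
    simp only at h
    subst h
    have h1 := (Finset.mem_filter.1 (Finset.mem_coe.1 hq)).2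
    have h2 := (Finset.mem_filter.1 (Finset.mem_coe.1 hq')).2
    rw [mobInc_snd hl h1 h2]

lemma mob_line {p : ℕ} [Fact p.Prime] {lam : ZMod p} (hl : lam ≠ 0) {s : ZMod p × (ZMod p × ZMod p)}
    {x0 y0 x y : ZMod p} (h0 : mobInc lam s (x0, y0)) (h : mobInc lam s (x, y)) (hx : x ≠ x0) (hy : y ≠ y0) :
    ((x0 + s.1) / (y0 + s.2.1)) ^ 2 * (1 / (x - x0)) + ((x0 + s.1) - (y0 + s.2.1)) / (y0 + s.2.1) ^ 2 = 1 / (y - y0) := by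
  obtain ⟨h1, h2, h3⟩ := h
  obtain ⟨h1', h2', h3'⟩ := h0
  simp only at *
  rw [← h3'] at h3
  have hx1 : x - x0 ≠ 0 := sub_ne_zero.2 hx
  have hy1 : y - y0 ≠ 0 := sub_ne_zero.2 hy
  obtain ⟨P, hP⟩ : ∃ P, P = x0 + s.1 := ⟨_, rfl⟩
  obtain ⟨Q, hQ⟩ : ∃ P, P = y0 + s.2.1 := ⟨_, rfl⟩
  obtain ⟨X, hX⟩ : ∃ P, P = x - x0 := ⟨_, rfl⟩
  obtain ⟨Y, hY⟩ : ∃ P, P = y - y0 := ⟨_, rfl⟩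
  have e1 : x + s.1 = P + X := by rw [hP, hX]; ring
  have e2 : y + s.2.1 = Q + Y := by rw [hQ, hY]; ring
  rw [e1, e2, ← hP, ← hQ] at h3
  rw [e1] at h1
  rw [e2] at h2
  rw [← hP] at h1'
  rw [← hQ] at h2'
  rw [← hX] at hx1 ⊢
  rw [← hY] at hy1 ⊢
  rw [← hP, ← hQ]
  have h4 : lam * (Q * (Q + Y) * X - P * (P + X) * Y) = 0 := by
    have h5 : lam / P - lam / (P + X) - (lam / Q - lam / (Q + Y)) = 0 := by linear_combination -h3
    have h6 : lam / P - lam / (P + X) - (lam / Q - lam / (Q + Y)) =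
      lam * (Q * (Q + Y) * X - P * (P + X) * Y) / (P * (P + X) * Q * (Q + Y)) := by
      field_simp
      ring
    rw [h6, div_eq_zero_iff] at h5
    rcases h5 with h5 | h5
    · exact h5
    · exfalso
      exact mul_ne_zero (mul_ne_zero (mul_ne_zero h1' h1) h2') h2 h5
  have h5 := (mul_eq_zero.1 h4).resolve_left hl
  field_simp
  linear_combination -h5

lemma mob_pencil {p : ℕ} [Fact p.Prime] {lam : ZMod p} (hl : lam ≠ 0) (A : Finset (ZMod p))
    (k : ℕ) (hk : 3 ≤ k) (hkp : 4 * 10 ^ 14 * A.card ^ 3 ≤ k ^ 2 * p)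
    (S : Finset (ZMod p × (ZMod p × ZMod p))) (hz : ∀ s ∈ S, s.2.2 ≠ 0) (hS : ∀ s ∈ S, k ≤ mobN lam A s)
    (x0 y0 : ZMod p) (h0 : ∀ s ∈ S, mobInc lam s (x0, y0)) :
    (k : ℝ) ^ 4 * S.card ≤ 32 * 10 ^ 14 * (A.card : ℝ) ^ 5 := by
  classical
  let f : ZMod p × (ZMod p × ZMod p) → ZMod p × ZMod p := fun s =>
    (((x0 + s.1) / (y0 + s.2.1)) ^ 2, ((x0 + s.1) - (y0 + s.2.1)) / (y0 + s.2.1) ^ 2)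
  set A1 := (A.erase x0).image fun x => 1 / (x - x0) with hA1
  set A2 := (A.erase y0).image fun x => 1 / (x - y0) with hA2
  have hA1c : A1.card ≤ A.card := Finset.card_image_le.trans (Finset.card_erase_le)
  have hA2c : A2.card ≤ A.card := Finset.card_image_le.trans (Finset.card_erase_le)
  have h2to1 : S.card ≤ 2 * (S.image f).card := by
    apply Finset.card_le_mul_card_image
    intro l hl'
    obtain ⟨s0, hs0, hf0⟩ := Finset.mem_image.1 hl'
    have : (S.filter fun s => f s = l).card ≤ ({(x0 + s0.1) / (y0 + s0.2.1), -((x0 + s0.1) / (y0 + s0.2.1))} : Finset (ZMod p)).card := by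
      apply Finset.card_le_card_of_injOn (fun s => (x0 + s.1) / (y0 + s.2.1))
      · intro s hs
        have hs := (Finset.mem_filter.1 (Finset.mem_coe.1 hs)).2
        rw [← hf0] at hs
        have h1 := congrArg Prod.fst hs
        simp only [f] at h1
        simp only [Finset.coe_insert, Finset.coe_singleton, Set.mem_insert_iff, Set.mem_singleton_iff]
        exact sq_eq_sq_iff_eq_or_eq_neg.1 h1
      · intro s hs t ht hst
        have hs := (Finset.mem_filter.1 (Finset.mem_coe.1 hs))
        have ht := (Finset.mem_filter.1 (Finset.mem_coe.1 ht))
        have h1 := congrArg Prod.snd (hs.2.trans ht.2.symm)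
        simp only [f] at h1
        simp only at hst
        obtain ⟨a1, a2, a3⟩ := h0 s hs.1
        obtain ⟨b1, b2, b3⟩ := h0 t ht.1
        have hzt := hz t ht.1
        simp only at a1 a2 a3 b1 b2 b3
        obtain ⟨P, hP⟩ : ∃ P, P = x0 + s.1 := ⟨_, rfl⟩
        obtain ⟨Q, hQ⟩ : ∃ P, P = y0 + s.2.1 := ⟨_, rfl⟩
        obtain ⟨R, hR⟩ : ∃ P, P = x0 + t.1 := ⟨_, rfl⟩
        obtain ⟨T, hT⟩ : ∃ P, P = y0 + t.2.1 := ⟨_, rfl⟩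
        rw [← hP, ← hQ, ← hR, ← hT] at hst h1
        rw [← hP] at a1
        rw [← hQ] at a2
        rw [← hP, ← hQ] at a3
        rw [← hR] at b1
        rw [← hT] at b2
        rw [← hR, ← hT] at b3
        have hRT : R - T ≠ 0 := by
          intro h
          rw [sub_eq_zero.1 h, sub_self] at b3
          exact hzt b3.symm
        rw [div_eq_div_iff a2 b2] at hst
        rw [div_eq_div_iff (pow_ne_zero 2 a2) (pow_ne_zero 2 b2)] at h1
        have h3 : (Q * (R - T)) * (T - Q) = 0 := by
          linear_combination h1 - T * hst
        have h4 : T - Q = 0 := (mul_eq_zero.1 h3).resolve_left (mul_ne_zero a2 hRT)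
        have hTQ : T = Q := sub_eq_zero.1 h4
        rw [hTQ] at hst
        have hPR : P = R := mul_right_cancel₀ a2 hst
        refine Prod.ext ?_ (Prod.ext ?_ ?_)
        · linear_combination hPR - hP + hR
        · linear_combination -hTQ - hQ + hT
        · rw [← a3, ← b3, hPR, hTQ]
    exact this.trans Finset.card_le_two
  have hrich : ∀ l ∈ S.image f, k - 1 ≤ (A1.filter fun x => l.1 * x + l.2 ∈ A2).card := by
    intro l hl'
    obtain ⟨s, hs, rfl⟩ := Finset.mem_image.1 hl'
    have h1 := hS s hs
    have h2 : k - 1 ≤ (((A ×ˢ A).filter (mobInc lam s)).erase (x0, y0)).card := by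
      have := Finset.pred_card_le_card_erase (s := ((A ×ˢ A).filter (mobInc lam s))) (a := (x0, y0))
      unfold mobN at h1
      omega
    refine h2.trans ?_
    have hs0 := h0 s hs
    have hne : ∀ q ∈ ((A ×ˢ A).filter (mobInc lam s)).erase (x0, y0), q.1 ≠ x0 ∧ q.2 ≠ y0 := by
      rintro ⟨x, y⟩ hq
      rw [Finset.mem_erase, Finset.mem_filter] at hq
      constructor
      · rintro rfl
        exact hq.1 (by rw [mobInc_snd hl hq.2.2 hs0])
      · rintro rfl
        exact hq.1 (by rw [mobInc_fst hl hq.2.2 hs0])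
    apply Finset.card_le_card_of_injOn (fun q => 1 / (q.1 - x0))
    · rintro ⟨x, y⟩ hq
      have hq := Finset.mem_coe.1 hq
      have hn := hne _ hq
      rw [Finset.mem_erase, Finset.mem_filter, Finset.mem_product] at hq
      simp only at hn hq ⊢
      rw [Finset.mem_coe, Finset.mem_filter]
      refine ⟨Finset.mem_image.2 ⟨x, Finset.mem_erase.2 ⟨hn.1, hq.2.1.1⟩, rfl⟩, ?_⟩
      simp only [f]
      rw [mob_line hl hs0 hq.2.2 hn.1 hn.2]
      exact Finset.mem_image.2 ⟨y, Finset.mem_erase.2 ⟨hn.2, hq.2.1.2⟩, rfl⟩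
    · rintro ⟨x, y⟩ hq ⟨x', y'⟩ hq' h
      have hq := Finset.mem_coe.1 hq
      have hq' := Finset.mem_coe.1 hq'
      have hn := hne _ hq
      have hn' := hne _ hq'
      simp only at h hn hn'
      have h1 : x - x0 ≠ 0 := sub_ne_zero.2 hn.1
      have h1' : x' - x0 ≠ 0 := sub_ne_zero.2 hn'.1
      rw [div_eq_div_iff h1 h1'] at h
      have hx : x = x' := by linear_combination -h
      subst hx
      rw [Finset.mem_erase, Finset.mem_filter] at hq hq'
      rw [mobInc_snd hl hq.2.2 hq'.2.2]
  obtain ⟨j, rfl⟩ : ∃ j, k = j + 1 := ⟨k - 1, by omega⟩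
  have hj : 2 ≤ j := by omega
  have := rich_lines A1 A2 A.card j hA1c hA2c hj (by
    have h4 : (j + 1) ^ 2 ≤ 4 * j ^ 2 := by nlinarith
    have h5 : (j + 1) ^ 2 * p ≤ 4 * j ^ 2 * p := by gcongr
    generalize (j+1)^2 * p = X at *
    generalize A.card ^ 3 = Y at *
    have : 4 * j ^ 2 * p = 4 * (j ^ 2 * p) := by ring
    rw [this] at h5
    omega) (S.image f) (by simpa using hrich)
  have hjr : (2 : ℝ) ≤ j := by exact_mod_cast hj
  have h6 : (((j + 1 : ℕ)) : ℝ) ^ 4 ≤ 16 * (j : ℝ) ^ 4 := by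
    push_cast
    calc ((j : ℝ) + 1) ^ 4 ≤ (2 * (j : ℝ)) ^ 4 := by gcongr; linarith
      _ = _ := by ring
  have h7 : (S.card : ℝ) ≤ 2 * (S.image f).card := by exact_mod_cast h2to1
  calc (((j + 1 : ℕ)) : ℝ) ^ 4 * S.card ≤ (16 * (j : ℝ) ^ 4) * (2 * (S.image f).card) := by gcongr
    _ = 32 * ((j : ℝ) ^ 4 * (S.image f).card) := by ring
    _ ≤ 32 * (10 ^ 14 * (A.card : ℝ) ^ 5) := by gcongr
    _ = _ := by ring

lemma rich_mob {p : ℕ} [Fact p.Prime] {lam : ZMod p} (hl : lam ≠ 0) (A : Finset (ZMod p))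
    (k : ℕ) (hk : 3 ≤ k) (hkp : 4 * 10 ^ 14 * A.card ^ 3 ≤ k ^ 2 * p)
    (S : Finset (ZMod p × (ZMod p × ZMod p))) (hz : ∀ s ∈ S, s.2.2 ≠ 0) (hS : ∀ s ∈ S, k ≤ mobN lam A s) :
    (k : ℝ) ^ 5 * S.card ≤ 32 * 10 ^ 14 * (A.card : ℝ) ^ 7 := by
  classical
  have h1 : k * S.card ≤ ∑ q ∈ A ×ˢ A, (S.filter fun s => mobInc lam s q).card := by
    calc k * S.card = ∑ s ∈ S, k := by simp [mul_comm]
      _ ≤ ∑ s ∈ S, mobN lam A s := Finset.sum_le_sum hS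
      _ = _ := by
        simp only [mobN, Finset.card_filter]
        rw [Finset.sum_comm]
  have h1' : (k : ℝ) * S.card ≤ ∑ q ∈ A ×ˢ A, ((S.filter fun s => mobInc lam s q).card : ℝ) := by
    exact_mod_cast h1
  calc (k : ℝ) ^ 5 * S.card = (k : ℝ) ^ 4 * (k * S.card) := by ring
    _ ≤ (k : ℝ) ^ 4 * ∑ q ∈ A ×ˢ A, ((S.filter fun s => mobInc lam s q).card : ℝ) := by gcongr
    _ = ∑ q ∈ A ×ˢ A, (k : ℝ) ^ 4 * ((S.filter fun s => mobInc lam s q).card : ℝ) := Finset.mul_sum _ _ _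
    _ ≤ ∑ q ∈ A ×ˢ A, 32 * 10 ^ 14 * (A.card : ℝ) ^ 5 := by
        apply Finset.sum_le_sum
        intro q _
        refine mob_pencil hl A k hk hkp _ ?_ ?_ q.1 q.2 ?_
        · intro s hs; exact hz s (Finset.mem_filter.1 hs).1
        · intro s hs; exact hS s (Finset.mem_filter.1 hs).1
        · intro s hs; exact (Finset.mem_filter.1 hs).2
    _ = _ := by
        rw [Finset.sum_const, Finset.card_product, nsmul_eq_mul]
        push_cast
        ring

lemma rich_sum {p : ℕ} [Fact p.Prime] {lam : ZMod p} (hl : lam ≠ 0) (A : Finset (ZMod p))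
    (k : ℕ) (hk : 3 ≤ k) (hkp : 4 * 10 ^ 14 * A.card ^ 3 ≤ k ^ 2 * p) :
    (∑ s ∈ (Finset.univ.filter fun s : ZMod p × (ZMod p × ZMod p) => s.2.2 ≠ 0).filter
      (fun s => k ≤ mobN lam A s), mobN lam A s : ℝ) ≤ 64 * 10 ^ 14 * (A.card : ℝ) ^ 7 / k ^ 4 := by
  classical
  have hkr : (0 : ℝ) < k := by exact_mod_cast (by omega : 0 < k)
  have := layer (Finset.univ.filter fun s : ZMod p × (ZMod p × ZMod p) => s.2.2 ≠ 0) (mobN lam A) k (by omega)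
    (32 * 10 ^ 14 * (A.card : ℝ) ^ 7 / k ^ 3) (by
      intro t ht
      have h1 := rich_mob hl A t (by omega) (hkp.trans (by gcongr))
        ((Finset.univ.filter fun s : ZMod p × (ZMod p × ZMod p) => s.2.2 ≠ 0).filter fun i => t ≤ mobN lam A i)
        (by
          intro s hs
          exact (Finset.mem_filter.1 (Finset.mem_filter.1 hs).1).2)
        (by
          intro s hs
          exact (Finset.mem_filter.1 hs).2)
      rw [le_div_iff₀ (by positivity)]
      refine le_trans ?_ h1
      have : (k : ℝ) ^ 3 ≤ (t : ℝ) ^ 3 := by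
        have : (k : ℝ) ≤ t := by exact_mod_cast ht
        gcongr
      calc _ ≤ (#{i ∈ {s : ZMod p × (ZMod p × ZMod p) | s.2.2 ≠ 0} | t ≤ mobN lam A i} : ℝ) * (t : ℝ) ^ 2 * (t : ℝ) ^ 3 := by gcongr
        _ = _ := by ring)
  refine this.trans (le_of_eq ?_)
  field_simp
  norm_num
  ring

/-- The triples. -/
def tri {p : ℕ} [Fact p.Prime] (lam : ZMod p) (A B C : Finset (ZMod p)) (y : ZMod p) :
    Finset (ZMod p × (ZMod p × ZMod p)) :=
  (A ×ˢ (B ×ˢ C)).filter fun t => t.1 + t.2.1 ≠ 0 ∧ lam / (t.1 + t.2.1) - t.2.2 = y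

/-- The curve attached to `((b,b'),(c,c'))`. -/
def gw {p : ℕ} (w : (ZMod p × ZMod p) × (ZMod p × ZMod p)) : ZMod p × (ZMod p × ZMod p) :=
  (w.1.1, (w.1.2, w.2.1 - w.2.2))

lemma tri_sq {p : ℕ} [Fact p.Prime] (lam : ZMod p) (A B C : Finset (ZMod p)) :
    ∑ y, (tri lam A B C y).card ^ 2 ≤ ∑ w ∈ (B ×ˢ B) ×ˢ (C ×ˢ C), mobN lam A (gw w) := by
  classical
  calc ∑ y, (tri lam A B C y).card ^ 2 = ∑ y, (tri lam A B C y ×ˢ tri lam A B C y).card := by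
        simp [Finset.card_product, sq]
    _ = (Finset.univ.sigma fun y => tri lam A B C y ×ˢ tri lam A B C y).card := (Finset.card_sigma _ _).symm
    _ ≤ (((B ×ˢ B) ×ˢ (C ×ˢ C)).sigma fun w => (A ×ˢ A).filter (mobInc lam (gw w))).card := by
        apply Finset.card_le_card_of_injOn
          (fun s => ⟨((s.2.1.2.1, s.2.2.2.1), (s.2.1.2.2, s.2.2.2.2)), (s.2.1.1, s.2.2.1)⟩)
        · rintro ⟨y, ⟨a, b, c⟩, ⟨a', b', c'⟩⟩ hs
          simp only [tri, Finset.mem_coe, Finset.mem_sigma, Finset.mem_filter, Finset.mem_product, Finset.mem_univ, true_and] at hs ⊢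
          obtain ⟨⟨⟨q1, q2, q3⟩, q4, q5⟩, ⟨⟨q6, q7, q8⟩, q9, q10⟩⟩ := hs
          refine ⟨⟨⟨q2, q7⟩, q3, q8⟩, ⟨q1, q6⟩, q4, q9, ?_⟩
          simp only [gw]
          linear_combination q5 - q10
        · rintro ⟨y, ⟨a, b, c⟩, ⟨a', b', c'⟩⟩ hs ⟨z, ⟨d, e, f⟩, ⟨d', e', f'⟩⟩ ht h
          simp only [Sigma.mk.injEq, Prod.mk.injEq, heq_eq_eq] at h
          obtain ⟨⟨⟨rfl, rfl⟩, rfl, rfl⟩, rfl, rfl⟩ := h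
          simp only [tri, Finset.mem_coe, Finset.mem_sigma, Finset.mem_filter, Finset.mem_product, Finset.mem_univ, true_and] at hs ht
          have : y = z := hs.1.2.2.symm.trans ht.1.2.2
          subst this
          rfl
    _ = _ := Finset.card_sigma _ _

lemma gw_fiber {p : ℕ} [Fact p.Prime] (W : Finset ((ZMod p × ZMod p) × (ZMod p × ZMod p))) (B C : Finset (ZMod p))
    (hW : W ⊆ (B ×ˢ B) ×ˢ (C ×ˢ C)) (s : ZMod p × (ZMod p × ZMod p)) :
    (W.filter fun w => gw w = s).card ≤ C.card := by
  apply Finset.card_le_card_of_injOn (fun w => w.2.2)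
  · intro w hw
    have := hW (Finset.mem_filter.1 (Finset.mem_coe.1 hw)).1
    simp only [Finset.mem_product] at this
    exact this.2.2
  · rintro ⟨⟨b, b'⟩, c, c'⟩ hw ⟨⟨d, d'⟩, e, e'⟩ hv h
    have h1 := (Finset.mem_filter.1 (Finset.mem_coe.1 hw)).2
    have h2 := (Finset.mem_filter.1 (Finset.mem_coe.1 hv)).2
    have h3 := h1.trans h2.symm
    simp only [gw, Prod.mk.injEq] at h3 h
    obtain ⟨rfl, rfl, h4⟩ := h3
    subst h
    have : c = e := by linear_combination h4
    rw [this]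

lemma J_rich {p : ℕ} [Fact p.Prime] {lam : ZMod p} (hl : lam ≠ 0) (A B C : Finset (ZMod p))
    (k : ℕ) (hk : 3 ≤ k) (hkp : 4 * 10 ^ 14 * A.card ^ 3 ≤ k ^ 2 * p) :
    (∑ w ∈ (B ×ˢ B) ×ˢ (C ×ˢ C), mobN lam A (gw w) : ℝ) ≤
      (A.card : ℝ) ^ 2 * (B.card * C.card) + k * ((B.card : ℝ) * C.card) ^ 2 +
        C.card * (64 * 10 ^ 14 * (A.card : ℝ) ^ 7 / k ^ 4) := by
  classical
  set W := (B ×ˢ B) ×ˢ (C ×ˢ C) with hW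
  rw [← Finset.sum_filter_add_sum_filter_not W (fun w => w.2.1 = w.2.2)]
  rw [← Finset.sum_filter_add_sum_filter_not (W.filter fun w => ¬ w.2.1 = w.2.2) (fun w => k ≤ mobN lam A (gw w))]
  have e1 : (∑ w ∈ W.filter (fun w => w.2.1 = w.2.2), mobN lam A (gw w) : ℝ) ≤ (A.card : ℝ) ^ 2 * (B.card * C.card) := by
    have : ∑ w ∈ W.filter (fun w => w.2.1 = w.2.2), mobN lam A (gw w) ≤ A.card ^ 2 * (B.card * C.card) := by
      calc ∑ w ∈ W.filter (fun w => w.2.1 = w.2.2), mobN lam A (gw w) =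
          ((W.filter (fun w => w.2.1 = w.2.2)).sigma fun w => (A ×ˢ A).filter (mobInc lam (gw w))).card :=
            (Finset.card_sigma _ _).symm
        _ ≤ ((A ×ˢ A) ×ˢ (B ×ˢ C)).card := by
            apply Finset.card_le_card_of_injOn (fun s => (s.2, (s.1.1.1, s.1.2.1)))
            · rintro ⟨⟨⟨b, b'⟩, c, c'⟩, a, a'⟩ hs
              simp only [hW, Finset.mem_coe, Finset.mem_sigma, Finset.mem_filter, Finset.mem_product] at hs ⊢
              exact ⟨hs.2.1, hs.1.1.1.1, hs.1.1.2.1⟩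
            · rintro ⟨⟨⟨b, b'⟩, c, c'⟩, a, a'⟩ hs ⟨⟨⟨d, d'⟩, e, e'⟩, f, f'⟩ ht h
              simp only [hW, Finset.mem_coe, Finset.mem_sigma, Finset.mem_filter, Finset.mem_product] at hs ht
              simp only [Prod.mk.injEq] at h
              obtain ⟨⟨rfl, rfl⟩, rfl, rfl⟩ := h
              obtain ⟨⟨-, rfl⟩, -, u1, u2, u3⟩ := hs
              obtain ⟨⟨-, rfl⟩, -, v1, v2, v3⟩ := ht
              simp only [gw] at u1 u2 u3 v1 v2 v3
              have h5 : lam / (a' + b') = lam / (a' + d') := by linear_combination v3 - u3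
              rw [div_eq_div_iff u2 v2] at h5
              have h6 := mul_left_cancel₀ hl h5
              have : b' = d' := by linear_combination -h6
              rw [this]
        _ = _ := by simp only [Finset.card_product]; ring
    exact_mod_cast this
  have e2 : (∑ w ∈ (W.filter fun w => ¬ w.2.1 = w.2.2).filter (fun w => ¬ k ≤ mobN lam A (gw w)), mobN lam A (gw w) : ℝ)
      ≤ k * ((B.card : ℝ) * C.card) ^ 2 := by
    calc _ ≤ ∑ w ∈ (W.filter fun w => ¬ w.2.1 = w.2.2).filter (fun w => ¬ k ≤ mobN lam A (gw w)), (k : ℝ) := by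
          apply Finset.sum_le_sum
          intro w hw
          have := (Finset.mem_filter.1 hw).2
          exact_mod_cast (by omega : mobN lam A (gw w) ≤ k)
      _ ≤ (W.card : ℝ) * k := by
          rw [Finset.sum_const, nsmul_eq_mul]
          have : ((W.filter fun w => ¬ w.2.1 = w.2.2).filter (fun w => ¬ k ≤ mobN lam A (gw w))).card ≤ W.card :=
            (Finset.card_filter_le _ _).trans (Finset.card_filter_le _ _)
          gcongr
      _ = _ := by
          rw [hW]; simp only [Finset.card_product]; push_cast; ring
  have e3 : (∑ w ∈ (W.filter fun w => ¬ w.2.1 = w.2.2).filter (fun w => k ≤ mobN lam A (gw w)), mobN lam A (gw w) : ℝ)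
      ≤ C.card * (64 * 10 ^ 14 * (A.card : ℝ) ^ 7 / k ^ 4) := by
    set W' := (W.filter fun w => ¬ w.2.1 = w.2.2).filter (fun w => k ≤ mobN lam A (gw w)) with hW'
    rw [Finset.sum_comp (fun s => (mobN lam A s : ℝ)) gw]
    have hsub : W' ⊆ (B ×ˢ B) ×ˢ (C ×ˢ C) := (Finset.filter_subset _ _).trans (Finset.filter_subset _ _)
    calc _ ≤ ∑ s ∈ W'.image gw, (C.card : ℝ) * mobN lam A s := by
          apply Finset.sum_le_sum
          intro s _
          rw [nsmul_eq_mul]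
          have := gw_fiber W' B C hsub s
          gcongr
      _ = C.card * ∑ s ∈ W'.image gw, (mobN lam A s : ℝ) := (Finset.mul_sum _ _ _).symm
      _ ≤ C.card * ∑ s ∈ (Finset.univ.filter fun s : ZMod p × (ZMod p × ZMod p) => s.2.2 ≠ 0).filter
          (fun s => k ≤ mobN lam A s), (mobN lam A s : ℝ) := by
          refine mul_le_mul_of_nonneg_left ?_ (Nat.cast_nonneg _)
          apply Finset.sum_le_sum_of_subset_of_nonneg
          · intro s hs
            obtain ⟨w, hw, rfl⟩ := Finset.mem_image.1 hs
            rw [hW', Finset.mem_filter, Finset.mem_filter] at hw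
            rw [Finset.mem_filter, Finset.mem_filter]
            exact ⟨⟨Finset.mem_univ _, sub_ne_zero.2 hw.1.2⟩, hw.2⟩
          · intro s _ _; exact Nat.cast_nonneg _
      _ ≤ _ := mul_le_mul_of_nonneg_left (rich_sum hl A k hk hkp) (Nat.cast_nonneg _)
  linarith

lemma mob_ext {p : ℕ} [Fact p.Prime] {lam : ZMod p} {q : ZMod p × ZMod p} {s t : ZMod p × (ZMod p × ZMod p)}
    (h1 : mobInc lam s q) (h2 : mobInc lam t q) (hb : s.1 = t.1) (hb' : s.2.1 = t.2.1) : s = t := by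
  refine Prod.ext hb (Prod.ext hb' ?_)
  rw [← h1.2.2, ← h2.2.2, hb, hb']

lemma mob_quad {p : ℕ} [Fact p.Prime] {lam : ZMod p} (hl : lam ≠ 0) {s : ZMod p × (ZMod p × ZMod p)}
    {x0 y0 x y : ZMod p} (h0 : mobInc lam s (x0, y0)) (h : mobInc lam s (x, y)) (hx : x ≠ x0) (hy : y ≠ y0) :
    (x0 + s.1) ^ 2 * (y - y0) + ((x0 + s.1) - (y0 + s.2.1)) * (x - x0) * (y - y0) =
      (y0 + s.2.1) ^ 2 * (x - x0) := by
  have h1 := mob_line hl h0 h hx hy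
  have h2 : y0 + s.2.1 ≠ 0 := h0.2.1
  have hx1 : x - x0 ≠ 0 := sub_ne_zero.2 hx
  have hy1 : y - y0 ≠ 0 := sub_ne_zero.2 hy
  generalize x0 + s.1 = P at *
  generalize y0 + s.2.1 = Q at *
  generalize x - x0 = X at *
  generalize y - y0 = Y at *
  field_simp at h1
  linear_combination h1

lemma pair_count {p : ℕ} [Fact p.Prime] {lam : ZMod p} (hl : lam ≠ 0) (q q' : ZMod p × ZMod p) :
    (Finset.univ.filter fun s => mobInc lam s q ∧ mobInc lam s q').card ≤
      (if q = q' then p ^ 2 else 0) + p + (if q'.1 - q.1 = q'.2 - q.2 then p else 0) := by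
  classical
  by_cases hqq : q = q'
  · rw [if_pos hqq]
    have : (Finset.univ.filter fun s => mobInc lam s q ∧ mobInc lam s q').card ≤ (Finset.univ : Finset (ZMod p × ZMod p)).card := by
      apply Finset.card_le_card_of_injOn (fun s => (s.1, s.2.1))
      · intro s _; simp
      · intro s hs t ht h
        have hs := (Finset.mem_filter.1 (Finset.mem_coe.1 hs)).2.1
        have ht := (Finset.mem_filter.1 (Finset.mem_coe.1 ht)).2.1
        simp only [Prod.mk.injEq] at h
        exact mob_ext hs ht h.1 h.2
    rw [Finset.card_univ, Fintype.card_prod, ZMod.card, ← sq] at this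
    omega
  obtain ⟨x0, y0⟩ := q
  obtain ⟨x, y⟩ := q'
  by_cases hx : x = x0
  · have : (Finset.univ.filter fun s => mobInc lam s (x0, y0) ∧ mobInc lam s (x, y)) = ∅ := by
      rw [Finset.filter_eq_empty_iff]
      rintro s _ ⟨h1, h2⟩
      subst hx
      exact hqq (by rw [mobInc_snd hl h1 h2])
    rw [this]; simp
  by_cases hy : y = y0
  · have : (Finset.univ.filter fun s => mobInc lam s (x0, y0) ∧ mobInc lam s (x, y)) = ∅ := by
      rw [Finset.filter_eq_empty_iff]
      rintro s _ ⟨h1, h2⟩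
      subst hy
      exact hqq (by rw [mobInc_fst hl h1 h2])
    rw [this]; simp
  have hX : x - x0 ≠ 0 := sub_ne_zero.2 hx
  have hY : y - y0 ≠ 0 := sub_ne_zero.2 hy
  rw [if_neg hqq]
  simp only
  by_cases hXY : x - x0 = y - y0
  · rw [if_pos hXY]
    have : (Finset.univ.filter fun s => mobInc lam s (x0, y0) ∧ mobInc lam s (x, y)).card ≤
        (Finset.univ : Finset (ZMod p × Bool)).card := by
      apply Finset.card_le_card_of_injOn (fun s => (s.1, decide (x0 + s.1 = y0 + s.2.1)))
      · intro s _; simp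
      · intro s hs t ht h
        have hs := (Finset.mem_filter.1 (Finset.mem_coe.1 hs)).2
        have ht := (Finset.mem_filter.1 (Finset.mem_coe.1 ht)).2
        simp only [Prod.mk.injEq, decide_eq_decide] at h
        refine mob_ext hs.1 ht.1 h.1 ?_
        have h1 := mob_quad hl hs.1 hs.2 hx hy
        have h2 := mob_quad hl ht.1 ht.2 hx hy
        rw [← hXY] at h1 h2
        have key : ∀ s : ZMod p × (ZMod p × ZMod p), (x0 + s.1) ^ 2 * (x - x0) + ((x0 + s.1) - (y0 + s.2.1)) * (x - x0) * (x - x0) =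
            (y0 + s.2.1) ^ 2 * (x - x0) → x0 + s.1 = y0 + s.2.1 ∨ y0 + s.2.1 = -(x0 + s.1) - (x - x0) := by
          intro s hs
          have : (x - x0) * (((x0 + s.1) - (y0 + s.2.1)) * ((y0 + s.2.1) - (-(x0 + s.1) - (x - x0)))) = 0 := by
            linear_combination hs
          rcases mul_eq_zero.1 ((mul_eq_zero.1 this).resolve_left hX) with h | h
          · left; exact sub_eq_zero.1 h
          · right; exact sub_eq_zero.1 h
        by_cases hc : x0 + s.1 = y0 + s.2.1
        · have hc' := h.2.1 hc
          linear_combination hc' - hc + h.1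
        · have hc' : ¬ (x0 + t.1 = y0 + t.2.1) := fun h' => hc (h.2.2 h')
          have g1 := (key s h1).resolve_left hc
          have g2 := (key t h2).resolve_left hc'
          linear_combination g1 - g2 - h.1
    rw [Finset.card_univ, Fintype.card_prod, ZMod.card, Fintype.card_bool] at this
    omega
  · have : (Finset.univ.filter fun s => mobInc lam s (x0, y0) ∧ mobInc lam s (x, y)).card ≤
        (Finset.univ : Finset (ZMod p)).card := by
      apply Finset.card_le_card_of_injOn (fun s => (y0 + s.2.1) / (x0 + s.1))
      · intro s _; simp
      · intro s hs t ht h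
        have hs := (Finset.mem_filter.1 (Finset.mem_coe.1 hs)).2
        have ht := (Finset.mem_filter.1 (Finset.mem_coe.1 ht)).2
        have h1 := mob_quad hl hs.1 hs.2 hx hy
        have h2 := mob_quad hl ht.1 ht.2 hx hy
        have p1 : x0 + s.1 ≠ 0 := hs.1.1
        have p2 : x0 + t.1 ≠ 0 := ht.1.1
        simp only at h
        obtain ⟨m, hm⟩ : ∃ m, m = (y0 + s.2.1) / (x0 + s.1) := ⟨_, rfl⟩
        have hQ : y0 + s.2.1 = m * (x0 + s.1) := by rw [hm]; field_simp
        have hQ' : y0 + t.2.1 = m * (x0 + t.1) := by rw [hm, h]; field_simp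
        rw [hQ] at h1
        rw [hQ'] at h2
        have g1 : (x0 + s.1) * ((y - y0) - m ^ 2 * (x - x0)) = (m - 1) * (x - x0) * (y - y0) := by
          apply mul_left_cancel₀ p1
          linear_combination h1
        have g2 : (x0 + t.1) * ((y - y0) - m ^ 2 * (x - x0)) = (m - 1) * (x - x0) * (y - y0) := by
          apply mul_left_cancel₀ p2
          linear_combination h2
        by_cases hz : (y - y0) - m ^ 2 * (x - x0) = 0
        · exfalso
          rw [hz, mul_zero] at g1
          have hm1 : m - 1 = 0 := by
            have := g1.symm
            rw [mul_eq_zero, mul_eq_zero] at this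
            tauto
          have hm1' : m = 1 := sub_eq_zero.1 hm1
          rw [hm1'] at hz
          exact hXY (by linear_combination -hz)
        · have hP : x0 + s.1 = x0 + t.1 := mul_right_cancel₀ hz (g1.trans g2.symm)
          refine mob_ext hs.1 ht.1 (by linear_combination hP) ?_
          linear_combination hQ - hQ' + m * hP
    rw [Finset.card_univ, ZMod.card] at this
    omega

lemma mobN_sum {p : ℕ} [Fact p.Prime] (lam : ZMod p) (A : Finset (ZMod p)) :
    A.card ^ 2 * (p - 1) ^ 2 ≤ ∑ s, mobN lam A s := by
  classical
  have h1 : ∑ s, mobN lam A s = ∑ q ∈ A ×ˢ A, (Finset.univ.filter fun s => mobInc lam s q).card := by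
    simp only [mobN, Finset.card_filter]
    rw [Finset.sum_comm]
  rw [h1]
  calc A.card ^ 2 * (p - 1) ^ 2 = ∑ q ∈ A ×ˢ A, (p - 1) ^ 2 := by
        rw [Finset.sum_const, Finset.card_product, smul_eq_mul, sq]
    _ ≤ _ := by
        apply Finset.sum_le_sum
        rintro ⟨x, y⟩ _
        have h2 : ((Finset.univ.erase (-x)) ×ˢ (Finset.univ.erase (-y))).card = (p - 1) ^ 2 := by
          rw [Finset.card_product, Finset.card_erase_of_mem (Finset.mem_univ _), Finset.card_erase_of_mem (Finset.mem_univ _),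
            Finset.card_univ, ZMod.card, sq]
        rw [← h2]
        apply Finset.card_le_card_of_injOn (fun b => (b.1, (b.2, lam / (x + b.1) - lam / (y + b.2))))
        · rintro ⟨b, b'⟩ hb
          simp only [Finset.mem_coe, Finset.mem_product, Finset.mem_erase, Finset.mem_univ, and_true] at hb
          simp only [Finset.mem_coe, Finset.mem_filter, Finset.mem_univ, true_and]
          refine ⟨?_, ?_, rfl⟩
          · intro h; exact hb.1 (by linear_combination h)
          · intro h; exact hb.2 (by linear_combination h)
        · rintro ⟨b, b'⟩ _ ⟨c, c'⟩ _ h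
          simp only [Prod.mk.injEq] at h ⊢
          exact ⟨h.1, h.2.1⟩

lemma mobN_sq {p : ℕ} [Fact p.Prime] {lam : ZMod p} (hl : lam ≠ 0) (A : Finset (ZMod p)) :
    ∑ s, mobN lam A s ^ 2 ≤ A.card ^ 2 * p ^ 2 + A.card ^ 4 * p + A.card ^ 3 * p := by
  classical
  have h1 : ∑ s, mobN lam A s ^ 2 = ∑ q ∈ A ×ˢ A, ∑ q' ∈ A ×ˢ A,
      (Finset.univ.filter fun s => mobInc lam s q ∧ mobInc lam s q').card := by
    have : ∀ s, mobN lam A s ^ 2 = ∑ q ∈ A ×ˢ A, ∑ q' ∈ A ×ˢ A, if mobInc lam s q ∧ mobInc lam s q' then 1 else 0 := by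
      intro s
      rw [sq, mobN, Finset.card_filter, Finset.sum_mul_sum]
      apply Finset.sum_congr rfl; intro q _
      apply Finset.sum_congr rfl; intro q' _
      by_cases h : mobInc lam s q <;> by_cases h' : mobInc lam s q' <;> simp [h, h']
    simp only [this, Finset.card_filter]
    rw [Finset.sum_comm]
    apply Finset.sum_congr rfl; intro q _
    rw [Finset.sum_comm]
  rw [h1]
  calc _ ≤ ∑ q ∈ A ×ˢ A, ∑ q' ∈ A ×ˢ A, ((if q = q' then p ^ 2 else 0) + p + (if q'.1 - q.1 = q'.2 - q.2 then p else 0)) := by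
        apply Finset.sum_le_sum; intro q _
        apply Finset.sum_le_sum; intro q' _
        exact pair_count hl q q'
    _ ≤ ∑ q ∈ A ×ˢ A, (p ^ 2 + A.card ^ 2 * p + A.card * p) := by
        apply Finset.sum_le_sum; intro q hq
        rw [Finset.sum_add_distrib, Finset.sum_add_distrib]
        gcongr
        · rw [Finset.sum_ite_eq, if_pos hq]
        · rw [Finset.sum_const, Finset.card_product, smul_eq_mul, sq]
        · rw [← Finset.sum_filter, Finset.sum_const, smul_eq_mul]
          gcongr
          apply Finset.card_le_card_of_injOn (fun q' => q'.1)
          · intro q' h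
            exact (Finset.mem_product.1 (Finset.mem_filter.1 (Finset.mem_coe.1 h)).1).1
          · intro u hu v hv h
            have hu := (Finset.mem_filter.1 (Finset.mem_coe.1 hu)).2
            have hv := (Finset.mem_filter.1 (Finset.mem_coe.1 hv)).2
            simp only at h
            exact Prod.ext h (by linear_combination hv - hu + h)
    _ = _ := by
        rw [Finset.sum_const, Finset.card_product, smul_eq_mul]; ring

lemma mob_var {p : ℕ} [Fact p.Prime] {lam : ZMod p} (hl : lam ≠ 0) (A : Finset (ZMod p)) :
    ∑ s, ((mobN lam A s : ℝ) - (A.card : ℝ) ^ 2 / p) ^ 2 ≤ 9 * ((A.card : ℝ) * p) ^ 2 := by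
  have hp1 : 1 ≤ p := (Fact.out : p.Prime).one_le
  have hp : (1 : ℝ) ≤ p := by exact_mod_cast hp1
  have hA : (A.card : ℝ) ≤ p := by
    have := Finset.card_le_univ A
    rw [ZMod.card] at this
    exact_mod_cast this
  have h1 : (A.card : ℝ) ^ 2 * (p - 1) ^ 2 ≤ ∑ s, (mobN lam A s : ℝ) := by
    have := mobN_sum lam A
    have h2 : ((A.card ^ 2 * (p - 1) ^ 2 : ℕ) : ℝ) ≤ ((∑ s, mobN lam A s : ℕ) : ℝ) := by exact_mod_cast this
    push_cast [Nat.cast_sub hp1] at h2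
    exact h2
  have h2 : ∑ s, (mobN lam A s : ℝ) ^ 2 ≤ (A.card : ℝ) ^ 2 * p ^ 2 + (A.card : ℝ) ^ 4 * p + (A.card : ℝ) ^ 3 * p := by
    exact_mod_cast mobN_sq hl A
  have hc : (Finset.univ : Finset (ZMod p × (ZMod p × ZMod p))).card = p ^ 3 := by
    rw [Finset.card_univ, Fintype.card_prod, Fintype.card_prod, ZMod.card]; ring
  have ha : (0 : ℝ) ≤ A.card := Nat.cast_nonneg _
  generalize (A.card : ℝ) = a at *
  have h3 : ∑ s, ((mobN lam A s : ℝ) - a ^ 2 / p) ^ 2 =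
      ∑ s, (mobN lam A s : ℝ) ^ 2 - 2 * (a ^ 2 / p) * ∑ s, (mobN lam A s : ℝ) + p ^ 3 * (a ^ 2 / p) ^ 2 := by
    simp only [sub_sq]
    rw [Finset.sum_add_distrib, Finset.sum_sub_distrib, Finset.sum_const, hc, Finset.mul_sum, nsmul_eq_mul]
    push_cast
    congr 2
    apply Finset.sum_congr rfl; intro s _; ring
  rw [h3]
  have h4 : 2 * (a ^ 2 / p) * (a ^ 2 * (p - 1) ^ 2) ≤ 2 * (a ^ 2 / p) * ∑ s, (mobN lam A s : ℝ) := by gcongr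
  have h5 : (p : ℝ) ^ 3 * (a ^ 2 / p) ^ 2 - 2 * (a ^ 2 / p) * (a ^ 2 * (p - 1) ^ 2) = a ^ 4 * (4 - p) - 2 * a ^ 4 / p := by
    field_simp
    ring
  have h6 : 0 ≤ 2 * a ^ 4 / p := by positivity
  have h7 : a ^ 4 ≤ a ^ 2 * p ^ 2 := by
    calc a ^ 4 = a ^ 2 * a ^ 2 := by ring
      _ ≤ a ^ 2 * p ^ 2 := by gcongr
  have h8 : a ^ 3 * p ≤ a ^ 2 * p ^ 2 := by
    calc a ^ 3 * p = a ^ 2 * (a * p) := by ring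
      _ ≤ a ^ 2 * (p * p) := by gcongr
      _ = _ := by ring
  nlinarith [sq_nonneg (a * p)]

lemma hyp_le_tri {p : ℕ} [Fact p.Prime] {lam : ZMod p} (hl : lam ≠ 0) (A B C D : Finset (ZMod p)) :
    hypCount p lam A B C D ≤ ∑ d ∈ D, (tri lam A B C d).card := by
  classical
  rw [← Finset.card_sigma]
  apply Finset.card_le_card_of_injOn (fun x => ⟨x.2.2, (x.1.1, (x.1.2, x.2.1))⟩)
  · rintro ⟨⟨a, b⟩, c, d⟩ hx
    simp only [tri, Finset.mem_coe, Finset.mem_filter, Finset.mem_product, Finset.mem_sigma] at hx ⊢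
    obtain ⟨⟨⟨h1, h2⟩, h3, h4⟩, h5⟩ := hx
    have h6 : a + b ≠ 0 := by
      intro h; rw [h, zero_mul] at h5; exact hl h5.symm
    refine ⟨h4, ⟨h1, h2, h3⟩, h6, ?_⟩
    rw [← h5]
    field_simp
    ring
  · rintro ⟨⟨a, b⟩, c, d⟩ _ ⟨⟨a', b'⟩, c', d'⟩ _ h
    simp only [Sigma.mk.injEq, Prod.mk.injEq, heq_eq_eq] at h
    obtain ⟨rfl, rfl, rfl, rfl⟩ := h
    rfl

lemma tri_total {p : ℕ} [Fact p.Prime] (lam : ZMod p) (A B C : Finset (ZMod p)) :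
    A.card * (B.card * C.card) ≤ (∑ y, (tri lam A B C y).card) + A.card * C.card := by
  classical
  rw [← Finset.card_product, ← Finset.card_product,
    ← Finset.card_filter_add_card_filter_not (s := A ×ˢ (B ×ˢ C)) (fun t => t.1 + t.2.1 ≠ 0)]
  gcongr
  · rw [← Finset.card_sigma]
    apply Finset.card_le_card_of_injOn (fun t => ⟨lam / (t.1 + t.2.1) - t.2.2, t⟩)
    · intro t ht
      have ht := Finset.mem_filter.1 (Finset.mem_coe.1 ht)
      simp only [tri, Finset.mem_coe, Finset.mem_filter, Finset.mem_sigma, Finset.mem_univ, true_and]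
      exact ⟨ht.1, ht.2, trivial⟩
    · intro t _ t' _ h
      simp only [Sigma.mk.injEq, heq_eq_eq] at h
      exact h.2
  · rw [← Finset.card_product]
    apply Finset.card_le_card_of_injOn (fun t => (t.1, t.2.2))
    · intro t ht
      have ht := Finset.mem_filter.1 (Finset.mem_coe.1 ht)
      simp only [Finset.mem_product] at ht
      simp only [Finset.mem_coe, Finset.mem_product]
      exact ⟨ht.1.1, ht.1.2.2⟩
    · rintro ⟨a, b, c⟩ ht ⟨a', b', c'⟩ ht' h
      have g := (Finset.mem_filter.1 (Finset.mem_coe.1 ht)).2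
      have g' := (Finset.mem_filter.1 (Finset.mem_coe.1 ht')).2
      simp only [Prod.mk.injEq, not_not] at h g g'
      obtain ⟨rfl, rfl⟩ := h
      have : b = b' := by linear_combination g - g'
      rw [this]

lemma main_rich {p : ℕ} [Fact p.Prime] {lam : ZMod p} (hl : lam ≠ 0) (A B C D : Finset (ZMod p))
    (k : ℕ) (hk : 3 ≤ k) (hkp : 4 * 10 ^ 14 * A.card ^ 3 ≤ k ^ 2 * p) :
    (hypCount p lam A B C D : ℝ) ^ 2 ≤ D.card * ((A.card : ℝ) ^ 2 * (B.card * C.card) + k * ((B.card : ℝ) * C.card) ^ 2 +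
        C.card * (64 * 10 ^ 14 * (A.card : ℝ) ^ 7 / k ^ 4)) := by
  refine le_trans ?_ (mul_le_mul_of_nonneg_left (J_rich hl A B C k hk hkp) (Nat.cast_nonneg _))
  have h1 := hyp_le_tri hl A B C D
  have h2 : hypCount p lam A B C D ^ 2 ≤ D.card * ∑ w ∈ (B ×ˢ B) ×ˢ (C ×ˢ C), mobN lam A (gw w) := by
    calc hypCount p lam A B C D ^ 2 ≤ (∑ d ∈ D, (tri lam A B C d).card) ^ 2 := by gcongr
      _ ≤ D.card * ∑ d ∈ D, (tri lam A B C d).card ^ 2 := sq_sum_le_card_mul_sum_sq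
      _ ≤ D.card * ∑ d, (tri lam A B C d).card ^ 2 := by
          gcongr
          exact Finset.subset_univ D
      _ ≤ _ := by
          gcongr
          exact tri_sq lam A B C
  exact_mod_cast h2

lemma main_spec {p : ℕ} [Fact p.Prime] {lam : ZMod p} (hl : lam ≠ 0) (A B C D : Finset (ZMod p)) :
    ∃ X : ℝ, (hypCount p lam A B C D : ℝ) - (A.card : ℝ) * B.card * C.card * D.card / p ≤ X ∧
      X ^ 2 ≤ D.card * (2 * (A.card : ℝ) ^ 2 * (B.card * C.card) +
        3 * (p * A.card * (B.card * C.card) * Real.sqrt C.card)) := by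
  classical
  have hp1 : 1 ≤ p := (Fact.out : p.Prime).one_le
  have hp : (1 : ℝ) ≤ p := by exact_mod_cast hp1
  have hCp : (C.card : ℝ) ≤ p := by
    have := Finset.card_le_univ C
    rw [ZMod.card] at this
    exact_mod_cast this
  set ψ : ZMod p → ℝ := fun y => ((tri lam A B C y).card : ℝ) with hψ
  obtain ⟨a, ha⟩ : ∃ a : ℝ, a = A.card := ⟨_, rfl⟩
  obtain ⟨b, hb⟩ : ∃ a : ℝ, a = B.card := ⟨_, rfl⟩
  obtain ⟨c, hc⟩ : ∃ a : ℝ, a = C.card := ⟨_, rfl⟩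
  obtain ⟨d, hd⟩ : ∃ a : ℝ, a = D.card := ⟨_, rfl⟩
  have ha0 : 0 ≤ a := by rw [ha]; exact Nat.cast_nonneg _
  have hb0 : 0 ≤ b := by rw [hb]; exact Nat.cast_nonneg _
  have hc0 : 0 ≤ c := by rw [hc]; exact Nat.cast_nonneg _
  have hd0 : 0 ≤ d := by rw [hd]; exact Nat.cast_nonneg _
  obtain ⟨μ, hμ⟩ : ∃ μ : ℝ, μ = a * b * c / p := ⟨_, rfl⟩
  have hμ0 : 0 ≤ μ := by rw [hμ]; positivity
  have hvar := mob_var hl A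
  rw [← hc] at hCp
  refine ⟨∑ y ∈ D, (ψ y - μ), ?_, ?_⟩
  · have h1 : (hypCount p lam A B C D : ℝ) ≤ ∑ y ∈ D, ψ y := by
      simp only [hψ]; exact_mod_cast hyp_le_tri hl A B C D
    rw [Finset.sum_sub_distrib, Finset.sum_const, nsmul_eq_mul, ← hd, ← ha, ← hb, ← hc]
    have : a * b * c * d / p = d * μ := by rw [hμ]; ring
    linarith
  rw [← hd, ← ha, ← hb, ← hc]
  -- total
  have hT : a * (b * c) ≤ ∑ y, ψ y + a * c := by
    rw [ha, hb, hc]; simp only [hψ]; exact_mod_cast tri_total lam A B C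
  have hS : ∑ y, ψ y ^ 2 ≤ ∑ w ∈ (B ×ˢ B) ×ˢ (C ×ˢ C), (mobN lam A (gw w) : ℝ) := by
    simp only [hψ]; exact_mod_cast tri_sq lam A B C
  set W := (B ×ˢ B) ×ˢ (C ×ˢ C) with hW
  have hWc : (W.card : ℝ) = b ^ 2 * c ^ 2 := by
    rw [hW]; simp only [Finset.card_product]; push_cast; rw [hb, hc]; ring
  set r : ZMod p × (ZMod p × ZMod p) → ℝ := fun s => ((W.filter fun w => gw w = s).card : ℝ) with hr
  have hrsum : ∑ s, r s = b ^ 2 * c ^ 2 := by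
    rw [← hWc, hr]
    have := Finset.card_eq_sum_card_fiberwise (s := W) (t := Finset.univ) (f := gw) (fun _ _ => Finset.mem_coe.2 (Finset.mem_univ _))
    simp only []
    exact_mod_cast this.symm
  have hrle : ∀ s, r s ≤ c := by
    intro s
    rw [hc]
    simp only [hr]
    exact_mod_cast gw_fiber W B C (Finset.Subset.refl _) s
  have hr0 : ∀ s, 0 ≤ r s := fun s => Nat.cast_nonneg _
  have hr2 : ∑ s, r s ^ 2 ≤ b ^ 2 * c ^ 3 := by
    calc ∑ s, r s ^ 2 ≤ ∑ s, c * r s := by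
          apply Finset.sum_le_sum; intro s _
          rw [sq]; exact mul_le_mul_of_nonneg_right (hrle s) (hr0 s)
      _ = c * (b ^ 2 * c ^ 2) := by rw [← Finset.mul_sum, hrsum]
      _ = _ := by ring
  set F : ZMod p × (ZMod p × ZMod p) → ℝ := fun s => (mobN lam A s : ℝ) - a ^ 2 / p with hF
  have hF2 : ∑ s, F s ^ 2 ≤ 9 * (a * p) ^ 2 := by
    rw [hF, ha]; exact hvar
  have hwF : ∑ w ∈ W, F (gw w) = ∑ s, r s * F s := by
    rw [← Finset.sum_fiberwise_of_maps_to (s := W) (t := Finset.univ) (g := gw) (fun _ _ => Finset.mem_univ _)]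
    apply Finset.sum_congr rfl
    intro s _
    rw [Finset.sum_congr rfl (g := fun _ => F s)]
    · rw [Finset.sum_const, nsmul_eq_mul]
    · intro w hw; rw [(Finset.mem_filter.1 hw).2]
  have hwle : ∑ w ∈ W, F (gw w) ≤ 3 * (p * a * (b * c) * Real.sqrt c) := by
    refine le_trans (le_abs_self _) (abs_le_of_sq_le_sq ?_ (by positivity))
    rw [hwF]
    calc (∑ s, r s * F s) ^ 2 ≤ (∑ s, r s ^ 2) * ∑ s, F s ^ 2 := Finset.sum_mul_sq_le_sq_mul_sq _ _ _
      _ ≤ (b ^ 2 * c ^ 3) * (9 * (a * p) ^ 2) := by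
          apply mul_le_mul hr2 hF2 (Finset.sum_nonneg (fun _ _ => sq_nonneg _)) (by positivity)
      _ = (3 * (p * a * (b * c))) ^ 2 * c := by ring
      _ = (3 * (p * a * (b * c))) ^ 2 * (Real.sqrt c) ^ 2 := by rw [Real.sq_sqrt hc0]
      _ = _ := by ring
  have hJ : ∑ w ∈ W, (mobN lam A (gw w) : ℝ) = ∑ w ∈ W, F (gw w) + b ^ 2 * c ^ 2 * (a ^ 2 / p) := by
    rw [hF, Finset.sum_sub_distrib, Finset.sum_const, nsmul_eq_mul, hWc]; ring
  have hvarψ : ∑ y, (ψ y - μ) ^ 2 ≤ 2 * a ^ 2 * (b * c) + 3 * (p * a * (b * c) * Real.sqrt c) := by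
    have h3 : ∑ y, (ψ y - μ) ^ 2 = ∑ y, ψ y ^ 2 - 2 * μ * ∑ y, ψ y + p * μ ^ 2 := by
      simp only [sub_sq]
      rw [Finset.sum_add_distrib, Finset.sum_sub_distrib, Finset.sum_const, Finset.card_univ, ZMod.card, Finset.mul_sum, nsmul_eq_mul]
      congr 2
      apply Finset.sum_congr rfl; intro s _; ring
    rw [h3]
    have h4 : 2 * μ * (a * (b * c)) ≤ 2 * μ * (∑ y, ψ y + a * c) := by gcongr
    have h5 : b ^ 2 * c ^ 2 * (a ^ 2 / p) = p * μ ^ 2 := by rw [hμ]; field_simp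
    have h6 : μ * (a * (b * c)) = p * μ ^ 2 := by rw [hμ]; field_simp
    have h7 : μ * (a * c) ≤ a ^ 2 * (b * c) := by
      rw [hμ, div_mul_eq_mul_div, div_le_iff₀ (by positivity)]
      calc a * b * c * (a * c) = a ^ 2 * (b * c) * c := by ring
        _ ≤ a ^ 2 * (b * c) * p := by gcongr
    rw [hJ] at hS
    linarith
  calc (∑ y ∈ D, (ψ y - μ)) ^ 2 ≤ D.card * ∑ y ∈ D, (ψ y - μ) ^ 2 := sq_sum_le_card_mul_sum_sq
    _ ≤ d * ∑ y, (ψ y - μ) ^ 2 := by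
        rw [← hd]
        refine mul_le_mul_of_nonneg_left ?_ hd0
        exact Finset.sum_le_sum_of_subset_of_nonneg (Finset.subset_univ D) (fun _ _ _ => sq_nonneg _)
    _ ≤ _ := mul_le_mul_of_nonneg_left hvarψ hd0

lemma hyp_triv1 {p : ℕ} [Fact p.Prime] {lam : ZMod p} (hl : lam ≠ 0) (A B C D : Finset (ZMod p)) :
    hypCount p lam A B C D ≤ A.card * (B.card * C.card) := by
  rw [← Finset.card_product, ← Finset.card_product]
  apply Finset.card_le_card_of_injOn (fun x => (x.1.1, (x.1.2, x.2.1)))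
  · rintro ⟨⟨a, b⟩, c, d⟩ hx
    simp only [Finset.mem_coe, Finset.mem_filter, Finset.mem_product] at hx ⊢
    exact ⟨hx.1.1.1, hx.1.1.2, hx.1.2.1⟩
  · rintro ⟨⟨a, b⟩, c, d⟩ hx ⟨⟨a', b'⟩, c', d'⟩ hx' h
    simp only [Finset.mem_coe, Finset.mem_filter] at hx hx'
    simp only [Prod.mk.injEq] at h
    obtain ⟨rfl, rfl, rfl⟩ := h
    have h6 : a + b ≠ 0 := by
      intro h; rw [h, zero_mul] at hx; exact hl hx.2.symm
    have := mul_left_cancel₀ h6 (hx.2.trans hx'.2.symm)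
    have : d = d' := by linear_combination this
    rw [this]

lemma hyp_triv2 {p : ℕ} [Fact p.Prime] {lam : ZMod p} (hl : lam ≠ 0) (A B C D : Finset (ZMod p)) :
    hypCount p lam A B C D ≤ D.card * (B.card * C.card) := by
  rw [← Finset.card_product, ← Finset.card_product]
  apply Finset.card_le_card_of_injOn (fun x => (x.2.2, (x.1.2, x.2.1)))
  · rintro ⟨⟨a, b⟩, c, d⟩ hx
    simp only [Finset.mem_coe, Finset.mem_filter, Finset.mem_product] at hx ⊢
    exact ⟨hx.1.2.2, hx.1.1.2, hx.1.2.1⟩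
  · rintro ⟨⟨a, b⟩, c, d⟩ hx ⟨⟨a', b'⟩, c', d'⟩ hx' h
    simp only [Finset.mem_coe, Finset.mem_filter] at hx hx'
    simp only [Prod.mk.injEq] at h
    obtain ⟨rfl, rfl, rfl⟩ := h
    have h6 : c + d ≠ 0 := by
      intro h; rw [h, mul_zero] at hx; exact hl hx.2.symm
    have := mul_right_cancel₀ h6 (hx.2.trans hx'.2.symm)
    have : a = a' := by linear_combination this
    rw [this]

lemma hyp_triv3 {p : ℕ} [Fact p.Prime] {lam : ZMod p} (hl : lam ≠ 0) (A B C D : Finset (ZMod p)) :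
    hypCount p lam A B C D ≤ A.card * (D.card * B.card) := by
  rw [← Finset.card_product, ← Finset.card_product]
  apply Finset.card_le_card_of_injOn (fun x => (x.1.1, (x.2.2, x.1.2)))
  · rintro ⟨⟨a, b⟩, c, d⟩ hx
    simp only [Finset.mem_coe, Finset.mem_filter, Finset.mem_product] at hx ⊢
    exact ⟨hx.1.1.1, hx.1.2.2, hx.1.1.2⟩
  · rintro ⟨⟨a, b⟩, c, d⟩ hx ⟨⟨a', b'⟩, c', d'⟩ hx' h
    simp only [Finset.mem_coe, Finset.mem_filter] at hx hx'
    simp only [Prod.mk.injEq] at h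
    obtain ⟨rfl, rfl, rfl⟩ := h
    have h6 : a + b ≠ 0 := by
      intro h; rw [h, zero_mul] at hx; exact hl hx.2.symm
    have := mul_left_cancel₀ h6 (hx.2.trans hx'.2.symm)
    have : c = c' := by linear_combination this
    rw [this]

lemma energy_ge1 {p : ℕ} [Fact p.Prime] (B C : Finset (ZMod p)) :
    B.card * C.card ≤ addEnergy p B C := by
  rw [← Finset.card_product]
  apply Finset.card_le_card_of_injOn (fun x => ((x.1, x.1), (x.2, x.2)))
  · rintro ⟨b, c⟩ hx
    simp only [Finset.mem_coe, Finset.mem_filter, Finset.mem_product] at hx ⊢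
    exact ⟨⟨⟨hx.1, hx.1⟩, hx.2, hx.2⟩, trivial⟩
  · rintro ⟨b, c⟩ _ ⟨b', c'⟩ _ h
    simp only [Prod.mk.injEq] at h ⊢
    exact ⟨h.1.1, h.2.1⟩

lemma energy_ge2 {p : ℕ} [Fact p.Prime] (B C : Finset (ZMod p)) :
    (B.card * C.card) ^ 2 ≤ p * addEnergy p B C := by
  classical
  let N : ZMod p → Finset (ZMod p × ZMod p) := fun y => (B ×ˢ C).filter fun t => t.1 + t.2 = y
  have h1 : (B ×ˢ C).card = ∑ y, (N y).card :=
    Finset.card_eq_sum_card_fiberwise (fun _ _ => Finset.mem_coe.2 (Finset.mem_univ _))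
  rw [← Finset.card_product, h1]
  calc (∑ y, (N y).card) ^ 2 ≤ (Finset.univ : Finset (ZMod p)).card * ∑ y, (N y).card ^ 2 := sq_sum_le_card_mul_sum_sq
    _ = p * ∑ y, (N y ×ˢ N y).card := by
        rw [Finset.card_univ, ZMod.card]; simp [Finset.card_product, sq]
    _ ≤ _ := by
        gcongr
        rw [← Finset.card_sigma]
        apply Finset.card_le_card_of_injOn (fun s => ((s.2.1.1, s.2.2.1), (s.2.1.2, s.2.2.2)))
        · rintro ⟨y, ⟨b, c⟩, ⟨b', c'⟩⟩ hs
          simp only [N, Finset.mem_coe, Finset.mem_sigma, Finset.mem_filter, Finset.mem_product, Finset.mem_univ, true_and] at hs ⊢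
          exact ⟨⟨⟨hs.1.1.1, hs.2.1.1⟩, hs.1.1.2, hs.2.1.2⟩, hs.1.2.trans hs.2.2.symm⟩
        · rintro ⟨y, ⟨b, c⟩, ⟨b', c'⟩⟩ hs ⟨z, ⟨d, e⟩, ⟨d', e'⟩⟩ ht h
          simp only [N, Finset.mem_coe, Finset.mem_sigma, Finset.mem_filter, Finset.mem_product, Finset.mem_univ, true_and] at hs ht
          simp only [Prod.mk.injEq] at h
          obtain ⟨⟨rfl, rfl⟩, rfl, rfl⟩ := h
          have : y = z := hs.1.2.symm.trans ht.1.2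
          subst this
          rfl

lemma stmt2_core {p : ℕ} [Fact p.Prime] {lam : ZMod p} (hl : lam ≠ 0) (A B C D : Finset (ZMod p))
    (hA : A.Nonempty) (hB : B.Nonempty) (hC : C.Nonempty) (hD : D.Nonempty)
    (κ : ℝ) (hk1 : Real.sqrt A.card ≤ κ)
    (hk2 : 3 / 2 * Real.log A.card - (Real.log B.card + Real.log C.card) / 3 ≤ Real.log κ)
    (hk3 : 3 / 2 * Real.log A.card - (Real.log B.card + Real.log C.card) / 4 - Real.log p / 12 ≤ Real.log κ) :
    ∃ X : ℝ, (hypCount p lam A B C D : ℝ) - (A.card : ℝ) * B.card * C.card * D.card / p ≤ X ∧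
      X ^ 2 ≤ 10 ^ 8 * (D.card * ((B.card : ℝ) * C.card) ^ 2 * κ) := by
  have hpp : p.Prime := Fact.out
  have hp : (1 : ℝ) ≤ p := by exact_mod_cast hpp.one_le
  have hle : ∀ S : Finset (ZMod p), (S.card : ℝ) ≤ p := by
    intro S
    have := Finset.card_le_univ S
    rw [ZMod.card] at this
    exact_mod_cast this
  have hge : ∀ S : Finset (ZMod p), S.Nonempty → (1 : ℝ) ≤ S.card := by
    intro S hS
    exact_mod_cast hS.card_pos
  have t1 : (hypCount p lam A B C D : ℝ) ≤ A.card * (B.card * C.card) := by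
    exact_mod_cast hyp_triv1 hl A B C D
  have t2 : (hypCount p lam A B C D : ℝ) ≤ D.card * (B.card * C.card) := by
    exact_mod_cast hyp_triv2 hl A B C D
  have t3 : (hypCount p lam A B C D : ℝ) ≤ A.card * (D.card * B.card) := by
    exact_mod_cast hyp_triv3 hl A B C D
  have hI0 : (0 : ℝ) ≤ (hypCount p lam A B C D : ℝ) := Nat.cast_nonneg _
  have hrich := main_rich hl A B C D
  have hspec := main_spec hl A B C D
  have hkp : ∀ k : ℕ, 4 * 10 ^ 14 * (A.card : ℝ) ^ 3 ≤ (k : ℝ) ^ 2 * p →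
      4 * 10 ^ 14 * A.card ^ 3 ≤ k ^ 2 * p := by
    intro k hk; exact_mod_cast hk
  replace hrich := fun k hk hh => hrich k hk (hkp k hh)
  clear hkp
  have a1 := hge A hA
  have b1 := hge B hB
  have c1 := hge C hC
  have d1 := hge D hD
  have ap := hle A
  have bp := hle B
  have cp := hle C
  have dp := hle D
  generalize (hypCount p lam A B C D : ℝ) = I at *
  generalize (A.card : ℝ) = a at *
  generalize (B.card : ℝ) = b at *
  generalize (C.card : ℝ) = c at *
  generalize (D.card : ℝ) = d at *
  generalize (p : ℝ) = q at *
  clear hA hB hC hD hle hge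
  have a0 : 0 < a := by linarith
  have b0 : 0 < b := by linarith
  have c0 : 0 < c := by linarith
  have d0 : 0 < d := by linarith
  have q0 : 0 < q := by linarith
  have hκ1 : 1 ≤ κ := le_trans (by rw [Real.one_le_sqrt]; exact a1) hk1
  have κ0 : 0 < κ := by linarith
  have hm : 0 ≤ a * b * c * d / q := by positivity
  have la : 0 ≤ Real.log a := Real.log_nonneg a1
  have lb : 0 ≤ Real.log b := Real.log_nonneg b1
  have lc : 0 ≤ Real.log c := Real.log_nonneg c1
  have ld : 0 ≤ Real.log d := Real.log_nonneg d1
  have lap := Real.log_le_log a0 ap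
  have lbp := Real.log_le_log b0 bp
  have lcp := Real.log_le_log c0 cp
  have ldp := Real.log_le_log d0 dp
  have hk0 : Real.log a / 2 ≤ Real.log κ := by
    rw [← Real.log_sqrt a0.le]
    exact Real.log_le_log (Real.sqrt_pos.2 a0) hk1
  have ex : ∀ {x y : ℝ}, 0 < x → 0 < y → Real.log x ≤ Real.log y → x ≤ y :=
    fun hx hy h => (Real.log_le_log_iff hx hy).1 h
  have hT0 : 0 < d * (b * c) ^ 2 * κ := by positivity
  -- trivial cases
  have triv : I ^ 2 ≤ 10 ^ 8 * (d * (b * c) ^ 2 * κ) → ∃ X : ℝ, I - a * b * c * d / q ≤ X ∧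
      X ^ 2 ≤ 10 ^ 8 * (d * (b * c) ^ 2 * κ) := fun h => ⟨I, by linarith, h⟩
  by_cases h1 : 2 * Real.log a ≤ Real.log d + Real.log κ
  · apply triv
    have : a ^ 2 ≤ d * κ := by
      apply ex (by positivity) (by positivity)
      rw [Real.log_pow, Real.log_mul d0.ne' κ0.ne']; push_cast; linarith
    calc I ^ 2 ≤ (a * (b * c)) ^ 2 := by gcongr
      _ = a ^ 2 * (b * c) ^ 2 := by ring
      _ ≤ (d * κ) * (b * c) ^ 2 := by gcongr
      _ = 1 * (d * (b * c) ^ 2 * κ) := by ring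
      _ ≤ _ := by gcongr; norm_num
  by_cases h2 : 2 * Real.log a + Real.log d ≤ 2 * Real.log c + Real.log κ
  · apply triv
    have : a ^ 2 * d ≤ c ^ 2 * κ := by
      apply ex (by positivity) (by positivity)
      rw [Real.log_mul (by positivity) d0.ne', Real.log_mul (by positivity) κ0.ne', Real.log_pow, Real.log_pow]
      push_cast; linarith
    calc I ^ 2 ≤ (a * (d * b)) ^ 2 := by gcongr
      _ = (a ^ 2 * d) * (d * b ^ 2) := by ring
      _ ≤ (c ^ 2 * κ) * (d * b ^ 2) := by gcongr
      _ = 1 * (d * (b * c) ^ 2 * κ) := by ring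
      _ ≤ _ := by gcongr; norm_num
  by_cases h3 : Real.log a ≤ Real.log κ
  · apply triv
    have : a ≤ κ := ex a0 κ0 h3
    calc I ^ 2 = I * I := by ring
      _ ≤ (a * (b * c)) * (d * (b * c)) := by gcongr
      _ = a * (d * (b * c) ^ 2) := by ring
      _ ≤ κ * (d * (b * c) ^ 2) := by gcongr
      _ = 1 * (d * (b * c) ^ 2 * κ) := by ring
      _ ≤ _ := by gcongr; norm_num
  push Not at h1 h2 h3
  have l2 : 2 * Real.log a ≤ Real.log κ + (Real.log b + Real.log c) := by linarith
  have l3 : 7 * Real.log a + Real.log c ≤ 5 * Real.log κ + 2 * (Real.log b + Real.log c) := by linarith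
  have e2 : a ^ 2 ≤ κ * (b * c) := by
    apply ex (by positivity) (by positivity)
    rw [Real.log_mul (by positivity) (by positivity), Real.log_mul b0.ne' c0.ne', Real.log_pow]
    push_cast; linarith
  have e3 : c * a ^ 7 ≤ κ ^ 5 * (b * c) ^ 2 := by
    apply ex (by positivity) (by positivity)
    rw [Real.log_mul (by positivity) (by positivity), Real.log_mul (by positivity) (by positivity), Real.log_pow,
      Real.log_pow, Real.log_pow, Real.log_mul b0.ne' c0.ne']
    push_cast; linarith
  by_cases h4 : 2 * Real.log κ + Real.log q < 3 * Real.log a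
  · have l4 : Real.log q + Real.log a + Real.log c / 2 ≤ Real.log κ + (Real.log b + Real.log c) := by linarith
    have e4 : q * a * Real.sqrt c ≤ κ * (b * c) := by
      apply ex (by positivity) (by positivity)
      rw [Real.log_mul (by positivity) (by positivity), Real.log_mul (by positivity) (by positivity),
        Real.log_mul (by positivity) (by positivity), Real.log_mul (by positivity) (by positivity), Real.log_sqrt c0.le]
      linarith
    obtain ⟨X, hX, hX2⟩ := hspec
    refine ⟨X, hX, hX2.trans ?_⟩
    calc d * (2 * a ^ 2 * (b * c) + 3 * (q * a * (b * c) * Real.sqrt c))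
        = d * (2 * a ^ 2 * (b * c) + 3 * (q * a * Real.sqrt c) * (b * c)) := by ring
      _ ≤ d * (2 * (κ * (b * c)) * (b * c) + 3 * (κ * (b * c)) * (b * c)) := by gcongr
      _ = 5 * (d * (b * c) ^ 2 * κ) := by ring
      _ ≤ _ := by gcongr; norm_num
  push Not at h4
  have e4 : a ^ 3 ≤ κ ^ 2 * q := by
    apply ex (by positivity) (by positivity)
    rw [Real.log_mul (by positivity) (by positivity), Real.log_pow, Real.log_pow]
    push_cast; linarith
  obtain ⟨k, hkk⟩ : ∃ k : ℕ, k = ⌈3 * 10 ^ 7 * κ⌉₊ := ⟨_, rfl⟩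
  have kl : 3 * 10 ^ 7 * κ ≤ k := by rw [hkk]; exact Nat.le_ceil _
  have ku : (k : ℝ) ≤ 6 * 10 ^ 7 * κ := by
    have := Nat.ceil_lt_add_one (a := 3 * 10 ^ 7 * κ) (by positivity)
    rw [← hkk] at this
    linarith
  have k3 : 3 ≤ k := by
    have : (3 : ℝ) ≤ k := by linarith
    exact_mod_cast this
  apply triv
  refine (hrich k k3 ?_).trans ?_
  · calc 4 * 10 ^ 14 * a ^ 3 ≤ 4 * 10 ^ 14 * (κ ^ 2 * q) := by gcongr
      _ ≤ 9 * 10 ^ 14 * (κ ^ 2 * q) := by gcongr; norm_num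
      _ = (3 * 10 ^ 7 * κ) ^ 2 * q := by ring
      _ ≤ _ := by gcongr
  · have e5 : c * (64 * 10 ^ 14 * a ^ 7 / k ^ 4) ≤ κ * (b * c) ^ 2 := by
      have : 64 * 10 ^ 14 * a ^ 7 / (k : ℝ) ^ 4 ≤ a ^ 7 / κ ^ 4 := by
        rw [div_le_div_iff₀ (by positivity) (by positivity)]
        have : (3 * 10 ^ 7 * κ) ^ 4 ≤ (k : ℝ) ^ 4 := by gcongr
        have h64 : 64 * 10 ^ 14 * κ ^ 4 ≤ (k : ℝ) ^ 4 := by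
          refine le_trans ?_ this
          have : 0 ≤ κ ^ 4 := by positivity
          nlinarith
        calc 64 * 10 ^ 14 * a ^ 7 * κ ^ 4 = a ^ 7 * (64 * 10 ^ 14 * κ ^ 4) := by ring
          _ ≤ _ := by gcongr
      calc c * (64 * 10 ^ 14 * a ^ 7 / k ^ 4) ≤ c * (a ^ 7 / κ ^ 4) := by gcongr
        _ = c * a ^ 7 / κ ^ 4 := by ring
        _ ≤ κ ^ 5 * (b * c) ^ 2 / κ ^ 4 := by gcongr
        _ = _ := by field_simp
    calc d * (a ^ 2 * (b * c) + k * (b * c) ^ 2 + c * (64 * 10 ^ 14 * a ^ 7 / k ^ 4))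
        ≤ d * (κ * (b * c) * (b * c) + 6 * 10 ^ 7 * κ * (b * c) ^ 2 + κ * (b * c) ^ 2) := by gcongr
      _ = (2 + 6 * 10 ^ 7) * (d * (b * c) ^ 2 * κ) := by ring
      _ ≤ _ := by gcongr; norm_num

lemma stmt2_aux {p : ℕ} [Fact p.Prime] {lam : ZMod p} (hl : lam ≠ 0) (A B C D : Finset (ZMod p)) :
    (hypCount p lam A B C D : ℝ) - (A.card : ℝ) * B.card * C.card * D.card / p ≤
      10 ^ 4 * ((A.card : ℝ) ^ ((1 : ℝ) / 4) * B.card * C.card * (D.card : ℝ) ^ ((1 : ℝ) / 2) +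
        (A.card : ℝ) ^ ((3 : ℝ) / 4) * ((B.card : ℝ) * C.card) ^ ((19 : ℝ) / 24) * (D.card : ℝ) ^ ((1 : ℝ) / 2) *
          (addEnergy p B C : ℝ) ^ ((1 : ℝ) / 24)) := by
  have hpp : p.Prime := Fact.out
  have hp0 : (0 : ℝ) < p := by exact_mod_cast hpp.pos
  by_cases hne : A.Nonempty ∧ B.Nonempty ∧ C.Nonempty ∧ D.Nonempty
  swap
  · have hI : hypCount p lam A B C D = 0 := by
      have t1 := hyp_triv1 hl A B C D
      have t2 := hyp_triv2 hl A B C D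
      by_contra h0
      apply hne
      have hpos := Nat.pos_of_ne_zero h0
      have u1 := lt_of_lt_of_le hpos t1
      have u2 := lt_of_lt_of_le hpos t2
      simp only [← Finset.card_pos]
      exact ⟨Nat.pos_of_mul_pos_right u1, Nat.pos_of_mul_pos_right (Nat.pos_of_mul_pos_left u1),
        Nat.pos_of_mul_pos_left (Nat.pos_of_mul_pos_left u1), Nat.pos_of_mul_pos_right u2⟩
    rw [hI]
    have h1 : (0 : ℝ) ≤ (A.card : ℝ) * B.card * C.card * D.card / p := by positivity
    push_cast
    refine le_trans (by linarith) (show (0 : ℝ) ≤ _ by positivity)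
  obtain ⟨hA, hB, hC, hD⟩ := hne
  have a0 : (0 : ℝ) < A.card := by exact_mod_cast hA.card_pos
  have b0 : (0 : ℝ) < B.card := by exact_mod_cast hB.card_pos
  have c0 : (0 : ℝ) < C.card := by exact_mod_cast hC.card_pos
  have d0 : (0 : ℝ) < D.card := by exact_mod_cast hD.card_pos
  have hE1 : (B.card : ℝ) * C.card ≤ addEnergy p B C := by exact_mod_cast energy_ge1 B C
  have hE2 : ((B.card : ℝ) * C.card) ^ 2 ≤ p * addEnergy p B C := by exact_mod_cast energy_ge2 B C
  have core := stmt2_core hl A B C D hA hB hC hD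
  clear hA hB hC hD
  generalize (hypCount p lam A B C D : ℝ) = I at *
  generalize (A.card : ℝ) = a at *
  generalize (B.card : ℝ) = b at *
  generalize (C.card : ℝ) = c at *
  generalize (D.card : ℝ) = d at *
  generalize (addEnergy p B C : ℝ) = E at *
  have E0 : 0 < E := lt_of_lt_of_le (by positivity) hE1
  have m0 : 0 < b * c := by positivity
  have lE1 : Real.log b + Real.log c ≤ Real.log E := by
    rw [← Real.log_mul b0.ne' c0.ne']; exact Real.log_le_log m0 hE1
  have lE2 : 2 * (Real.log b + Real.log c) ≤ Real.log p + Real.log E := by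
    rw [← Real.log_mul b0.ne' c0.ne', ← Real.log_mul hp0.ne' E0.ne']
    have := Real.log_le_log (by positivity) hE2
    rw [Real.log_pow] at this
    exact_mod_cast this
  obtain ⟨v, hv⟩ : ∃ v : ℝ, v = a ^ ((3 : ℝ) / 2) * (b * c) ^ (-(5 : ℝ) / 12) * E ^ ((1 : ℝ) / 12) := ⟨_, rfl⟩
  have v0 : 0 < v := by rw [hv]; positivity
  have lv : Real.log v = 3 / 2 * Real.log a - 5 / 12 * (Real.log b + Real.log c) + 1 / 12 * Real.log E := by
    rw [hv, Real.log_mul (by positivity) (by positivity), Real.log_mul (by positivity) (by positivity),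
      Real.log_rpow a0, Real.log_rpow m0, Real.log_rpow E0, Real.log_mul b0.ne' c0.ne']
    ring
  have lvk : Real.log v ≤ Real.log (Real.sqrt a + v) :=
    Real.log_le_log v0 (by linarith [Real.sqrt_nonneg a])
  obtain ⟨X, hX, hX2⟩ := core (Real.sqrt a + v) (by linarith) (by linarith) (by linarith)
  refine hX.trans (le_trans (le_abs_self X) (abs_le_of_sq_le_sq (hX2.trans ?_) (by positivity)))
  have s1 : (a ^ ((1 : ℝ) / 4) * b * c * d ^ ((1 : ℝ) / 2)) ^ 2 = d * (b * c) ^ 2 * Real.sqrt a := by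
    rw [Real.sqrt_eq_rpow]
    have x1 : (a ^ ((1 : ℝ) / 4)) ^ 2 = a ^ ((1 : ℝ) / 2) := by
      rw [← Real.rpow_natCast, ← Real.rpow_mul a0.le]; norm_num
    have x2 : (d ^ ((1 : ℝ) / 2)) ^ 2 = d := by
      rw [← Real.rpow_natCast, ← Real.rpow_mul d0.le]; norm_num
    calc _ = (a ^ ((1 : ℝ) / 4)) ^ 2 * (b * c) ^ 2 * (d ^ ((1 : ℝ) / 2)) ^ 2 := by ring
      _ = _ := by rw [x1, x2]; ring
  have s2 : (a ^ ((3 : ℝ) / 4) * (b * c) ^ ((19 : ℝ) / 24) * d ^ ((1 : ℝ) / 2) * E ^ ((1 : ℝ) / 24)) ^ 2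
      = d * (b * c) ^ 2 * v := by
    have x1 : (a ^ ((3 : ℝ) / 4)) ^ 2 = a ^ ((3 : ℝ) / 2) := by
      rw [← Real.rpow_natCast, ← Real.rpow_mul a0.le]; norm_num
    have x2 : (d ^ ((1 : ℝ) / 2)) ^ 2 = d := by
      rw [← Real.rpow_natCast, ← Real.rpow_mul d0.le]; norm_num
    have x3 : (E ^ ((1 : ℝ) / 24)) ^ 2 = E ^ ((1 : ℝ) / 12) := by
      rw [← Real.rpow_natCast, ← Real.rpow_mul E0.le]; norm_num
    have x4 : ((b * c) ^ ((19 : ℝ) / 24)) ^ 2 = (b * c) ^ 2 * (b * c) ^ (-(5 : ℝ) / 12) := by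
      rw [← Real.rpow_natCast, ← Real.rpow_mul m0.le, ← Real.rpow_natCast, ← Real.rpow_add m0]; norm_num
    calc _ = (a ^ ((3 : ℝ) / 4)) ^ 2 * ((b * c) ^ ((19 : ℝ) / 24)) ^ 2 * (d ^ ((1 : ℝ) / 2)) ^ 2 *
          (E ^ ((1 : ℝ) / 24)) ^ 2 := by ring
      _ = _ := by rw [x1, x2, x3, x4, hv]; ring
  have n1 : 0 ≤ a ^ ((1 : ℝ) / 4) * b * c * d ^ ((1 : ℝ) / 2) := by positivity
  have n2 : 0 ≤ a ^ ((3 : ℝ) / 4) * (b * c) ^ ((19 : ℝ) / 24) * d ^ ((1 : ℝ) / 2) * E ^ ((1 : ℝ) / 24) := by positivity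
  generalize a ^ ((1 : ℝ) / 4) * b * c * d ^ ((1 : ℝ) / 2) = u at *
  generalize a ^ ((3 : ℝ) / 4) * (b * c) ^ ((19 : ℝ) / 24) * d ^ ((1 : ℝ) / 2) * E ^ ((1 : ℝ) / 24) = w at *
  have : 0 ≤ u * w := mul_nonneg n1 n2
  calc 10 ^ 8 * (d * (b * c) ^ 2 * (Real.sqrt a + v)) = 10 ^ 8 * (u ^ 2 + w ^ 2) := by rw [s1, s2]; ring
    _ ≤ _ := by nlinarith

theorem stmt2 :
    ∃ C c : ℝ, 1 ≤ C ∧ 1 ≤ c ∧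
      ∀ (p : ℕ), p.Prime → Odd p →
        ∀ (lam : ZMod p), lam ≠ 0 →
          ∀ A B Cs D : Finset (ZMod p),
            (hypCount p lam A B Cs D : ℝ) -
                (A.card : ℝ) * B.card * Cs.card * D.card / p ≤
              C * Real.log p ^ c *
                ((A.card : ℝ) ^ ((1 : ℝ) / 4) * B.card * Cs.card *
                    (D.card : ℝ) ^ ((1 : ℝ) / 2) +
                  (A.card : ℝ) ^ ((3 : ℝ) / 4) *
                    ((B.card : ℝ) * Cs.card) ^ ((19 : ℝ) / 24) *
                    (D.card : ℝ) ^ ((1 : ℝ) / 2) *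
                    (addEnergy p B Cs : ℝ) ^ ((1 : ℝ) / 24)) := by
  refine ⟨10 ^ 4, 1, by norm_num, le_refl _, ?_⟩
  intro p hp hodd lam hl A B Cs D
  have : Fact p.Prime := ⟨hp⟩
  refine (stmt2_aux hl A B Cs D).trans ?_
  have hp3 : 3 ≤ p := by
    rcases hodd with ⟨k, hk⟩
    have := hp.two_le
    omega
  have hlog : 1 ≤ Real.log p := by
    rw [Real.le_log_iff_exp_le (by exact_mod_cast hp.pos)]
    have : (3 : ℝ) ≤ p := by exact_mod_cast hp3
    linarith [Real.exp_one_lt_d9]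
  rw [Real.rpow_one]
  apply mul_le_mul_of_nonneg_right _ (by positivity)
  linarith
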